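/- For any R > 0 and α ∈ (0, π/2), let u be the unique entire solution emanating from the planar front in Ω = Ω_{R,α}, and assume u propagates completely. Then there exist τ > 0, τ₂ ∈ ℝ, z₂ ∈ ℝ, δ > 0 and μ > 0 such that, for all t ≥ τ₂ and all x ∈ Ω̄ with x₁ > 0 and |x| ≥ L, u(t,x) ≥ φ(|x| − c(t − τ₂ + τ) + ((N−1)/c) ln(t − τ₂ + τ) + z₂) − δ e^{−δ ϑ(t − τ₂)} − δ e^{−μ(|x| − L)}, where ϑ(s) = (2/3)(ln(s+1))^{3/2} for s ≥ 0. -/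

import Mathlib

open Set Filter Topology MeasureTheory

noncomputable section

/-- `ℝ^N` with `N = d+1`, Euclidean structure. -/
abbrev Euc (d : ℕ) := EuclideanSpace ℝ (Fin (d + 1))

/-- The Euclidean norm of `x' = (x₂,…,x_N)` for `x = (x₁,x') ∈ ℝ^N`. -/
def primeNorm {d : ℕ} (x : Euc d) : ℝ :=
  Real.sqrt (∑ i, if i = 0 then 0 else (x i) ^ 2)

/-- The funnel-shaped domain `Ω = {x : |x'| < h(x₁)}`. -/
def funnel (d : ℕ) (h : ℝ → ℝ) : Set (Euc d) := {x | primeNorm x < h (x 0)}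

/-- The Laplacian of `g` at `x`, computed with derivatives taken within the set `s`. -/
def lapW {d : ℕ} (s : Set (Euc d)) (g : Euc d → ℝ) (x : Euc d) : ℝ :=
  ∑ i, fderivWithin ℝ (fun y => fderivWithin ℝ g s y (EuclideanSpace.single i 1)) s x
      (EuclideanSpace.single i 1)

/-- The quantity `ν·∇g` at a boundary point `x` of the funnel domain `Ω_{R,α}`, where
`ν(x) = (1+h'(x₁)²)^{-1/2}·(-h'(x₁), x'/|x'|)` is the outward unit normal. -/
def neumannLHS {d : ℕ} (h : ℝ → ℝ) (g : Euc d → ℝ) (x : Euc d) : ℝ :=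
  (Real.sqrt (1 + deriv h (x 0) ^ 2))⁻¹ *
    (-(deriv h (x 0)) * fderivWithin ℝ g (closure (funnel d h)) x (EuclideanSpace.single 0 1)
      + ∑ i, if i = 0 then 0 else
          (x i / primeNorm x) *
            fderivWithin ℝ g (closure (funnel d h)) x (EuclideanSpace.single i 1))

/-- The bistable nonlinearity `f`, of class `C^{1,1}`, with positive mass, extended affinely
outside `[0,1]`. -/
structure Bistable (f : ℝ → ℝ) (θ : ℝ) : Prop where
  smooth : ContDiff ℝ 1 f
  lip_deriv : ∃ C : NNReal, LipschitzWith C (deriv f)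
  f0 : f 0 = 0
  f1 : f 1 = 0
  df0 : deriv f 0 < 0
  df1 : deriv f 1 < 0
  θmem : θ ∈ Ioo (0 : ℝ) 1
  neg : ∀ s ∈ Ioo (0 : ℝ) θ, f s < 0
  pos : ∀ s ∈ Ioo θ (1 : ℝ), 0 < f s
  dθ : 0 < deriv f θ
  mass : 0 < ∫ s in (0 : ℝ)..1, f s
  ext_neg : ∀ s < (0 : ℝ), f s = deriv f 0 * s
  ext_pos : ∀ s > (1 : ℝ), f s = deriv f 1 * (s - 1)

/-- The planar traveling front `φ(x₁ - ct)`: `φ'' + cφ' + f(φ) = 0`, `φ(-∞) = 1`,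
`φ(+∞) = 0`, `0 < φ < 1`, `φ` decreasing, normalized by `φ(0) = θ`, with speed `c > 0`. -/
structure PlanarFront (f : ℝ → ℝ) (θ c : ℝ) (φ : ℝ → ℝ) : Prop where
  cpos : 0 < c
  mem : ∀ z : ℝ, φ z ∈ Ioo (0 : ℝ) 1
  smooth : ContDiff ℝ 2 φ
  anti : StrictAnti φ
  ode : ∀ z : ℝ, deriv (deriv φ) z + c * deriv φ z + f (φ z) = 0
  lim_bot : Tendsto φ atBot (nhds 1)
  lim_top : Tendsto φ atTop (nhds 0)
  pin : φ 0 = θ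

/-- `h : ℝ → ℝ` defines a funnel-shaped domain `Ω_{R,α}` (of dimension `N = d+1 ≥ 2`) with
cylinder radius `R`, opening angle `α` and transition parameter `L`. -/
structure IsFunnel (d : ℕ) (R α L : ℝ) (h : ℝ → ℝ) : Prop where
  dpos : 1 ≤ d
  Rpos : 0 < R
  αmem : α ∈ Ico (0 : ℝ) (Real.pi / 2)
  RL : R < L
  smooth : ContDiff ℝ 2 h
  holder : ∃ β : NNReal, 0 < β ∧ (β : ℝ) < 1 ∧ ∃ C : NNReal, HolderWith C β (deriv (deriv h))
  deriv_nonneg : ∀ x : ℝ, 0 ≤ deriv h x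
  deriv_le : ∀ x : ℝ, deriv h x ≤ Real.tan α
  left : ∀ x ≤ (0 : ℝ), h x = R
  right : ∀ x : ℝ, L * Real.cos α ≤ x → h x = x * Real.tan α

/-- An entire solution of `u_t = Δu + f(u)` in `ℝ × Ω̄` (with values in `[0,1]`),
Neumann boundary condition `ν·∇u = 0` on `ℝ × ∂Ω`, emanating from the planar front
`φ(x₁ - ct)` as `t → -∞`. -/
structure IsEntireSolution (d : ℕ) (h f : ℝ → ℝ) (c : ℝ) (φ : ℝ → ℝ)
    (u : ℝ → Euc d → ℝ) : Prop where
  range01 : ∀ t : ℝ, ∀ x ∈ closure (funnel d h), u t x ∈ Icc (0 : ℝ) 1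
  time_diff : ∀ x ∈ closure (funnel d h), Differentiable ℝ fun t => u t x
  space_reg : ∀ t : ℝ, ContDiffOn ℝ 2 (u t) (closure (funnel d h))
  pde : ∀ t : ℝ, ∀ x ∈ closure (funnel d h),
      deriv (fun s => u s x) t = lapW (closure (funnel d h)) (u t) x + f (u t x)
  neumann : ∀ t : ℝ, ∀ x ∈ frontier (funnel d h), neumannLHS h (u t) x = 0
  past : ∀ ε > (0 : ℝ), ∃ T : ℝ, ∀ t ≤ T, ∀ x ∈ closure (funnel d h),
      |u t x - φ (x 0 - c * t)| ≤ ε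

/-- Complete propagation: `u(t,x) → 1` as `t → +∞` locally uniformly in `x ∈ Ω̄`. -/
def CompletePropagation (d : ℕ) (h : ℝ → ℝ) (u : ℝ → Euc d → ℝ) : Prop :=
  TendstoLocallyUniformlyOn u (fun _ => (1 : ℝ)) atTop (closure (funnel d h))

/-- Blocking: `u(t,·)` converges uniformly on `Ω̄`, as `t → +∞`, to a stationary solution
`u_∞` with `u_∞(x) → 0` as `x₁ → +∞`. -/
def Blocked (d : ℕ) (h f : ℝ → ℝ) (u : ℝ → Euc d → ℝ) : Prop :=
  ∃ uinf : Euc d → ℝ,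
    TendstoUniformlyOn u uinf atTop (closure (funnel d h)) ∧
    ContDiffOn ℝ 2 uinf (closure (funnel d h)) ∧
    (∀ x ∈ closure (funnel d h), lapW (closure (funnel d h)) uinf x + f (uinf x) = 0) ∧
    (∀ x ∈ frontier (funnel d h), neumannLHS h uinf x = 0) ∧
    (∀ ε > (0 : ℝ), ∃ A : ℝ, ∀ x ∈ closure (funnel d h), A ≤ x 0 → |uinf x| ≤ ε)

/-- Stability of a solution `U` of `ΔU + f(U) = 0` on `s̄`:
`∫_s (|∇ψ|² - f'(U)ψ²) ≥ 0` for all compactly supported `C¹` functions `ψ`. -/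
def StableOn {d : ℕ} (s : Set (Euc d)) (f : ℝ → ℝ) (U : Euc d → ℝ) : Prop :=
  ∀ ψ : Euc d → ℝ, ContDiff ℝ 1 ψ → HasCompactSupport ψ →
    0 ≤ ∫ x in s, (‖gradient ψ x‖ ^ 2 - deriv f (U x) * ψ x ^ 2)

/-- The function `ϑ(s) = (2/3)·(ln(s+1))^{3/2}`. -/
def varTheta (s : ℝ) : ℝ := (2 / 3) * Real.log (s + 1) ^ ((3 : ℝ) / 2)

/-! ### Second-order conditions at a one-sided local maximum -/

/-- First and second order necessary conditions at a local maximum relative to a set `X`, along a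
direction `e` pointing into `X`. -/
theorem second_order_conditions {E : Type*} [NormedAddCommGroup E] [NormedSpace ℝ E]
    {X : Set E} {x : E} {g : E → ℝ} {T : E → E →L[ℝ] ℝ} {H : E →L[ℝ] E →L[ℝ] ℝ} (hx : x ∈ X)
    (hT : ∀ᶠ y in 𝓝[X] x, HasFDerivWithinAt g (T y) X y) (hH : HasFDerivWithinAt T H X x)
    (hmax : ∀ᶠ y in 𝓝[X] x, g y ≤ g x) {e : E} (he : ∀ᶠ s : ℝ in 𝓝[>] 0, x + s • e ∈ X) :
    T x e ≤ 0 ∧ (T x e = 0 → H e e ≤ 0) := by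
  have hline : Tendsto (fun s : ℝ => x + s • e) (𝓝[>] 0) (𝓝[X] x) := by
    refine tendsto_nhdsWithin_iff.2 ⟨?_, he⟩
    have : Continuous fun s : ℝ => x + s • e := by fun_prop
    simpa using (this.tendsto 0).mono_left nhdsWithin_le_nhds
  obtain ⟨s₀, hs₀, hI⟩ := mem_nhdsGT_iff_exists_Ioo_subset.1
    ((he.and (hline.eventually hT)).and (hline.eventually hmax))
  have hs₀' : (0 : ℝ) < s₀ := hs₀
  have hI' : ∀ s ∈ Ico (0 : ℝ) s₀, x + s • e ∈ X ∧ HasFDerivWithinAt g (T (x + s • e)) X (x + s • e) ∧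
      g (x + s • e) ≤ g x := by
    intro s hs
    rcases hs.1.eq_or_lt with h | h
    · subst h
      have h1 := hT.self_of_nhdsWithin hx
      simpa using ⟨hx, h1⟩
    · have := hI ⟨h, hs.2⟩
      exact ⟨this.1.1, this.1.2, this.2⟩
  have hlineD : ∀ s : ℝ, HasDerivWithinAt (fun s : ℝ => x + s • e) e (Ico 0 s₀) s := by
    intro s
    simpa using (((hasDerivAt_id s).smul_const e).const_add x).hasDerivWithinAt
  have hmaps : MapsTo (fun s : ℝ => x + s • e) (Ico 0 s₀) X := fun s hs => (hI' s hs).1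
  have hγ : ∀ s ∈ Ico (0 : ℝ) s₀,
      HasDerivWithinAt (fun s : ℝ => g (x + s • e)) (T (x + s • e) e) (Ico 0 s₀) s := fun s hs =>
    (hI' s hs).2.1.comp_hasDerivWithinAt s (hlineD s) hmaps
  have hIoi : Ico (0 : ℝ) s₀ ∈ 𝓝[>] (0 : ℝ) := Ico_mem_nhdsGT_of_mem ⟨le_rfl, hs₀'⟩
  have h0 : (0 : ℝ) ∈ Ico (0 : ℝ) s₀ := ⟨le_rfl, hs₀'⟩
  have hlt : ∀ᶠ s : ℝ in 𝓝[>] 0, s ∈ Ioo 0 s₀ := Ioo_mem_nhdsGT hs₀'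
  constructor
  · have h1 : HasDerivWithinAt (fun s : ℝ => g (x + s • e)) (T x e) (Ioi 0) 0 := by
      have := (hγ 0 h0).mono_of_mem_nhdsWithin hIoi
      rwa [zero_smul, add_zero] at this
    rw [hasDerivWithinAt_iff_tendsto_slope' (by simp)] at h1
    refine le_of_tendsto h1 ?_
    filter_upwards [hlt] with s hs
    have := (hI' s ⟨hs.1.le, hs.2⟩).2.2
    simp only [slope, vsub_eq_sub, sub_zero, zero_smul, add_zero, smul_eq_mul]
    exact mul_nonpos_of_nonneg_of_nonpos (inv_nonneg.2 hs.1.le) (by linarith)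
  · intro hTe
    by_contra! hpos
    have h2 : HasDerivWithinAt (fun s : ℝ => T (x + s • e) e) (H e e) (Ioi 0) 0 := by
      have hH' : HasFDerivWithinAt T H X (x + (0 : ℝ) • e) := by simpa using hH
      have := (hH'.comp_hasDerivWithinAt (0 : ℝ) (hlineD 0) hmaps).mono_of_mem_nhdsWithin
        hIoi
      simpa using this.clm_apply (hasDerivWithinAt_const (0 : ℝ) (Ioi 0) e)
    rw [hasDerivWithinAt_iff_tendsto_slope' (by simp)] at h2
    have h3 : ∀ᶠ s : ℝ in 𝓝[>] 0, 0 < T (x + s • e) e := by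
      filter_upwards [h2.eventually (lt_mem_nhds hpos), self_mem_nhdsWithin] with s hs hs0
      have hs0' : (0 : ℝ) < s := hs0
      simp only [slope, vsub_eq_sub, sub_zero, zero_smul, add_zero, smul_eq_mul, hTe] at hs
      exact (mul_pos_iff_of_pos_left (inv_pos.2 hs0')).1 hs
    obtain ⟨s₁, hs₁, hJ⟩ := mem_nhdsGT_iff_exists_Ioo_subset.1 (h3.and hlt)
    have hs₁' : (0 : ℝ) < s₁ := hs₁
    have hmono : StrictMonoOn (fun s : ℝ => g (x + s • e)) (Icc 0 (s₁ / 2)) := by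
      have hsub : ∀ s ∈ Icc (0 : ℝ) (s₁ / 2), s ∈ Ico (0 : ℝ) s₀ := by
        intro s hs
        rcases hs.1.eq_or_lt with h | h
        · exact h ▸ h0
        · have := (hJ ⟨h, by linarith [hs.2]⟩).2
          exact ⟨this.1.le, this.2⟩
      refine strictMonoOn_of_deriv_pos (convex_Icc _ _) ?_ ?_
      · intro s hs
        exact ((hγ s (hsub s hs)).continuousWithinAt).mono hsub
      · intro s hs
        rw [interior_Icc] at hs
        have h4 := hJ (⟨hs.1, by linarith [hs.2]⟩ : s ∈ Ioo 0 s₁)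
        have h5 : HasDerivAt (fun s : ℝ => g (x + s • e)) (T (x + s • e) e) s :=
          (hγ s ⟨h4.2.1.le, h4.2.2⟩).hasDerivAt (Ico_mem_nhds h4.2.1 h4.2.2)
        rw [h5.deriv]
        exact h4.1
    have h6 := hmono (⟨le_rfl, by linarith⟩ : (0 : ℝ) ∈ Icc 0 (s₁ / 2))
      (⟨by linarith, le_rfl⟩ : s₁ / 2 ∈ Icc 0 (s₁ / 2)) (by linarith)
    have h7 := (hI' (s₁ / 2) ⟨by linarith, (hJ (⟨by linarith, by linarith⟩ : s₁ / 2 ∈ Ioo 0 s₁)).2.2⟩).2.2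
    simp only [zero_smul, add_zero] at h6
    linarith

/-! ### Laplacian bookkeeping for explicit barriers -/

/-- `B` is `C²` at `x`, with differential `G` and Laplacian `l` there. -/
structure LapData {d : ℕ} (B : Euc d → ℝ) (x : Euc d) (G : Euc d →L[ℝ] ℝ) (l : ℝ) : Prop where
  smooth : ContDiffAt ℝ 2 B x
  grad : fderiv ℝ B x = G
  lap : ∑ i, fderiv ℝ (fun y => fderiv ℝ B y (EuclideanSpace.single i 1)) x
      (EuclideanSpace.single i 1) = l

namespace LapData

variable {d : ℕ} {B B' : Euc d → ℝ} {x : Euc d} {G G' : Euc d →L[ℝ] ℝ} {l l' : ℝ}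

theorem eventually_differentiableAt (h : ContDiffAt ℝ 2 B x) :
    ∀ᶠ y in 𝓝 x, DifferentiableAt ℝ B y := by
  filter_upwards [h.eventually (by simp)] with y hy
  exact hy.differentiableAt (by simp)

theorem differentiableAt_fderiv (h : ContDiffAt ℝ 2 B x) : DifferentiableAt ℝ (fderiv ℝ B) x :=
  (h.fderiv_right (m := 1) (by norm_num)).differentiableAt (by simp)

theorem differentiableAt_fderiv_apply (h : ContDiffAt ℝ 2 B x) (e : Euc d) :
    DifferentiableAt ℝ (fun y => fderiv ℝ B y e) x :=
  (differentiableAt_fderiv h).clm_apply (differentiableAt_const e)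

theorem const (a : ℝ) (x : Euc d) : LapData (fun _ => a) x 0 0 :=
  ⟨contDiffAt_const, by simp, by simp⟩

theorem add (h : LapData B x G l) (h' : LapData B' x G' l') :
    LapData (fun y => B y + B' y) x (G + G') (l + l') := by
  refine ⟨h.smooth.add h'.smooth, ?_, ?_⟩
  · rw [← h.grad, ← h'.grad]
    exact fderiv_add (h.smooth.differentiableAt (by simp)) (h'.smooth.differentiableAt (by simp))
  · rw [← h.lap, ← h'.lap, ← Finset.sum_add_distrib]
    refine Finset.sum_congr rfl fun i _ => ?_
    have : (fun y => fderiv ℝ (fun y => B y + B' y) y (EuclideanSpace.single i 1)) =ᶠ[𝓝 x]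
        fun y => fderiv ℝ B y (EuclideanSpace.single i 1) +
          fderiv ℝ B' y (EuclideanSpace.single i 1) := by
      filter_upwards [eventually_differentiableAt h.smooth,
        eventually_differentiableAt h'.smooth] with y hy hy'
      rw [fderiv_fun_add hy hy']; rfl
    rw [this.fderiv_eq, fderiv_fun_add (differentiableAt_fderiv_apply h.smooth _)
      (differentiableAt_fderiv_apply h'.smooth _)]
    rfl

theorem comp {Ψ : ℝ → ℝ} (h : LapData B x G l) (hΨ : ContDiffAt ℝ 2 Ψ (B x)) :
    LapData (fun y => Ψ (B y)) x (deriv Ψ (B x) • G)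
      (deriv (deriv Ψ) (B x) * ∑ i, G (EuclideanSpace.single i 1) ^ 2 + deriv Ψ (B x) * l) := by
  have hΨ1 : ∀ᶠ z in 𝓝 (B x), DifferentiableAt ℝ Ψ z := by
    filter_upwards [hΨ.eventually (by simp)] with z hz
    exact hz.differentiableAt (by simp)
  have hΨ2 : DifferentiableAt ℝ (deriv Ψ) (B x) := by
    have : DifferentiableAt ℝ (fun z => fderiv ℝ Ψ z 1) (B x) :=
      ((hΨ.fderiv_right (m := 1) (by norm_num)).differentiableAt (by simp)).clm_apply
        (differentiableAt_const _)
    simpa using this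
  have hBc : ContinuousAt B x := h.smooth.continuousAt
  have hBd : DifferentiableAt ℝ B x := h.smooth.differentiableAt (by simp)
  have hfd : ∀ᶠ y in 𝓝 x, fderiv ℝ (fun y => Ψ (B y)) y = deriv Ψ (B y) • fderiv ℝ B y := by
    filter_upwards [eventually_differentiableAt h.smooth, hBc.eventually hΨ1] with y hy hy'
    exact (hy'.hasDerivAt.comp_hasFDerivAt y hy.hasFDerivAt).fderiv
  refine ⟨hΨ.comp x h.smooth, ?_, ?_⟩
  · rw [hfd.self_of_nhds, h.grad]
  · rw [Finset.mul_sum, ← h.lap, Finset.mul_sum, ← Finset.sum_add_distrib]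
    refine Finset.sum_congr rfl fun i _ => ?_
    have h1 : (fun y => fderiv ℝ (fun y => Ψ (B y)) y (EuclideanSpace.single i 1)) =ᶠ[𝓝 x]
        fun y => deriv Ψ (B y) * fderiv ℝ B y (EuclideanSpace.single i 1) := by
      filter_upwards [hfd] with y hy
      rw [hy]; rfl
    have h2 : HasFDerivAt (fun y => deriv Ψ (B y)) (deriv (deriv Ψ) (B x) • fderiv ℝ B x) x :=
      hΨ2.hasDerivAt.comp_hasFDerivAt x hBd.hasFDerivAt
    rw [h1.fderiv_eq,
      (h2.fun_mul (differentiableAt_fderiv_apply h.smooth _).hasFDerivAt).fderiv, ← h.grad]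
    simp
    ring

theorem const_mul (h : LapData B x G l) (a : ℝ) :
    LapData (fun y => a * B y) x (a • G) (a * l) := by
  have := h.comp (Ψ := fun z => a * z) (by fun_prop)
  have hd : deriv (fun z : ℝ => a * z) = fun _ => a := by
    ext z; simp
  simpa [hd] using this

theorem sum {ι : Type*} {s : Finset ι} {Bs : ι → Euc d → ℝ} {Gs : ι → Euc d →L[ℝ] ℝ}
    {ls : ι → ℝ} (h : ∀ j ∈ s, LapData (Bs j) x (Gs j) (ls j)) :
    LapData (fun y => ∑ j ∈ s, Bs j y) x (∑ j ∈ s, Gs j) (∑ j ∈ s, ls j) := by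
  classical
  induction s using Finset.induction_on with
  | empty => simpa using LapData.const 0 x
  | insert a s ha ih =>
    simp only [Finset.sum_insert ha]
    exact (h a (by simp)).add (ih fun j hj => h j (by simp [hj]))

theorem congr (h : LapData B x G l) (hG : G = G') (hl : l = l') : LapData B x G' l' :=
  hG ▸ hl ▸ h

end LapData

/-! ### Solutions on the conical end -/

/-- The part of the closed cone `‖x‖ ≤ K x₁` outside the closed ball of radius `L`. -/
def coneEnd (d : ℕ) (K L : ℝ) : Set (Euc d) := {x | ‖x‖ ≤ K * x 0 ∧ L < ‖x‖}

/-- A (non-normalised) outward normal vector at the boundary points of the cone `‖x‖ ≤ K x₁`. -/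
def outward {d : ℕ} (K : ℝ) (x : Euc d) : Euc d := x - (K ^ 2 * x 0) • EuclideanSpace.single 0 1

/-- A solution with values in `[0,1]` of `u_t = Δu + f(u)` on a conical end, with Neumann
condition on the lateral boundary of the cone. -/
structure ConeSol (d : ℕ) (K L : ℝ) (f : ℝ → ℝ) (u : ℝ → Euc d → ℝ) : Prop where
  one_lt : 1 < K
  L_pos : 0 < L
  range01 : ∀ t : ℝ, ∀ x ∈ coneEnd d K L, u t x ∈ Icc (0 : ℝ) 1
  time_diff : ∀ x ∈ coneEnd d K L, Differentiable ℝ fun t => u t x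
  space_reg : ∀ t : ℝ, ContDiffOn ℝ 2 (u t) (coneEnd d K L)
  pde : ∀ t : ℝ, ∀ x ∈ coneEnd d K L,
      deriv (fun s => u s x) t = lapW (coneEnd d K L) (u t) x + f (u t x)
  neumann : ∀ t : ℝ, ∀ x ∈ coneEnd d K L, ‖x‖ = K * x 0 →
      fderivWithin ℝ (u t) (coneEnd d K L) x (outward K x) = 0

theorem continuous_coord {d : ℕ} (i : Fin (d + 1)) : Continuous fun x : Euc d => x i := by
  fun_prop

theorem convex_closedCone (d : ℕ) (K : ℝ) : Convex ℝ {x : Euc d | ‖x‖ ≤ K * x 0} := by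
  intro x hx y hy a b ha hb hab
  simp only [mem_ofPred_eq] at hx hy ⊢
  calc ‖a • x + b • y‖ ≤ ‖a • x‖ + ‖b • y‖ := norm_add_le _ _
    _ = a * ‖x‖ + b * ‖y‖ := by rw [norm_smul, norm_smul, Real.norm_of_nonneg ha,
        Real.norm_of_nonneg hb]
    _ ≤ a * (K * x 0) + b * (K * y 0) := by gcongr
    _ = K * (a • x + b • y) 0 := by simp; ring

theorem uniqueDiffOn_coneEnd {d : ℕ} {K : ℝ} (hK : 1 < K) (L : ℝ) :
    UniqueDiffOn ℝ (coneEnd d K L) := by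
  have hC : UniqueDiffOn ℝ {x : Euc d | ‖x‖ ≤ K * x 0} := by
    refine uniqueDiffOn_convex (convex_closedCone d K) ⟨EuclideanSpace.single 0 1, ?_⟩
    have hopen : IsOpen {x : Euc d | ‖x‖ < K * x 0} :=
      isOpen_lt continuous_norm (continuous_const.mul (continuous_coord 0))
    refine mem_interior.2 ⟨{x : Euc d | ‖x‖ < K * x 0}, ?_, hopen, ?_⟩
    · exact fun x (hx : ‖x‖ < K * x 0) => hx.le
    · simpa using hK
  exact hC.inter (isOpen_lt continuous_const continuous_norm)

theorem coord_zero_pos_of_mem_coneEnd {d : ℕ} {K L : ℝ} (hK : 1 < K) (hL : 0 < L) {x : Euc d}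
    (hx : x ∈ coneEnd d K L) : 0 < x 0 := by
  have h : 0 < K * x 0 := hL.trans (hx.2.trans_le hx.1)
  exact (mul_pos_iff_of_pos_left (by linarith)).1 h

theorem inner_outward {d : ℕ} (K : ℝ) (x e : Euc d) :
    inner ℝ (outward K x) e = inner ℝ x e - K ^ 2 * x 0 * e 0 := by
  simp [outward, inner_sub_left, inner_smul_left, EuclideanSpace.inner_single_left]

theorem outward_ne_zero {d : ℕ} {K L : ℝ} (hK : 1 < K) (hL : 0 < L) {x : Euc d}
    (hx : x ∈ coneEnd d K L) : outward K x ≠ 0 := by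
  intro h
  have h0 : (outward K x) 0 = 0 := by simp [h]
  have hpos := coord_zero_pos_of_mem_coneEnd hK hL hx
  simp only [outward, PiLp.sub_apply, PiLp.smul_apply, PiLp.single_apply, if_true,
    smul_eq_mul, mul_one] at h0
  nlinarith [mul_pos hpos (by nlinarith : 0 < K ^ 2 - 1)]

theorem eventually_add_smul_mem_coneEnd {d : ℕ} {K L : ℝ} (hK : 1 < K) (hL : 0 < L) {x e : Euc d}
    (hx : x ∈ coneEnd d K L) (he : ‖x‖ = K * x 0 → inner ℝ (outward K x) e < 0) :
    ∀ᶠ s : ℝ in 𝓝[>] 0, x + s • e ∈ coneEnd d K L := by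
  have hcont : Continuous fun s : ℝ => x + s • e := by fun_prop
  have hpos := coord_zero_pos_of_mem_coneEnd hK hL hx
  have h1 : ∀ᶠ s : ℝ in 𝓝[>] 0, L < ‖x + s • e‖ := by
    refine nhdsWithin_le_nhds (hcont.norm.continuousAt.eventually (lt_mem_nhds ?_))
    simpa using hx.2
  suffices h2 : ∀ᶠ s : ℝ in 𝓝[>] 0, ‖x + s • e‖ ≤ K * (x + s • e) 0 from h2.and h1
  rcases hx.1.lt_or_eq with hlt | heq
  · have : ∀ᶠ s : ℝ in 𝓝 0, ‖x + s • e‖ < K * (x + s • e) 0 := by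
      refine hcont.norm.continuousAt.eventually_lt
        (continuous_const.mul ((continuous_coord 0).comp hcont)).continuousAt ?_
      simpa using hlt
    exact nhdsWithin_le_nhds (this.mono fun s hs => hs.le)
  · have hneg := he heq
    rw [inner_outward] at hneg
    have h3 : ∀ᶠ s : ℝ in 𝓝 0,
        2 * (inner ℝ x e - K ^ 2 * x 0 * e 0) + s * (‖e‖ ^ 2 - K ^ 2 * e 0 ^ 2) < 0 := by
      have hc : Continuous fun s : ℝ =>
        2 * (inner ℝ x e - K ^ 2 * x 0 * e 0) + s * (‖e‖ ^ 2 - K ^ 2 * e 0 ^ 2) := by fun_prop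
      refine hc.continuousAt.eventually (gt_mem_nhds ?_)
      simp only [zero_mul, add_zero]
      linarith
    have h4 : ∀ᶠ s : ℝ in 𝓝 0, 0 < (x + s • e) 0 := by
      refine ((continuous_coord 0).comp hcont).continuousAt.eventually (lt_mem_nhds ?_)
      simpa using hpos
    filter_upwards [nhdsWithin_le_nhds h3, nhdsWithin_le_nhds h4, self_mem_nhdsWithin]
      with s hs3 hs4 hs0
    have hs0' : (0 : ℝ) < s := hs0
    refine abs_le_of_sq_le_sq' ?_ (mul_nonneg (by linarith) hs4.le) |>.2
    rw [norm_add_sq_real, norm_smul, inner_smul_right, heq, Real.norm_of_nonneg hs0'.le]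
    simp only [PiLp.add_apply, PiLp.smul_apply, smul_eq_mul]
    nlinarith [mul_pos hs0' (neg_pos.2 hs3)]

/-- If a smooth barrier with the correct normal derivative touches `v` from below at `x`, then the
Laplacians are ordered. -/
theorem lap_le_of_touching {d : ℕ} {K L : ℝ} (hK : 1 < K) (hL : 0 < L) {v : Euc d → ℝ}
    (hv : ContDiffOn ℝ 2 v (coneEnd d K L)) {x : Euc d} (hx : x ∈ coneEnd d K L)
    (hneu : ‖x‖ = K * x 0 → fderivWithin ℝ v (coneEnd d K L) x (outward K x) = 0)
    {B : Euc d → ℝ} {G : Euc d →L[ℝ] ℝ} {l : ℝ} (hB : LapData B x G l)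
    (hG : ‖x‖ = K * x 0 → G (outward K x) ≤ 0)
    (hmax : ∀ᶠ y in 𝓝[coneEnd d K L] x, B y - v y ≤ B x - v x) :
    l ≤ lapW (coneEnd d K L) v x := by
  set X := coneEnd d K L with hX
  have hU : UniqueDiffOn ℝ X := uniqueDiffOn_coneEnd hK L
  set ν := outward K x with hν
  have hν0 : ν ≠ 0 := outward_ne_zero hK hL hx
  have hν1 : 0 < inner ℝ ν ν := by
    rw [real_inner_self_eq_norm_sq]; positivity
  set T : Euc d → Euc d →L[ℝ] ℝ := fun y => fderiv ℝ B y - fderivWithin ℝ v X y with hTdef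
  have hT : ∀ᶠ y in 𝓝[X] x, HasFDerivWithinAt (fun y => B y - v y) (T y) X y := by
    filter_upwards [nhdsWithin_le_nhds (LapData.eventually_differentiableAt hB.smooth),
      self_mem_nhdsWithin] with y hy hyX
    exact hy.hasFDerivAt.hasFDerivWithinAt.fun_sub
      ((hv.differentiableOn (by simp)) y hyX).hasFDerivWithinAt
  have hv2 : DifferentiableWithinAt ℝ (fderivWithin ℝ v X) X x :=
    ((hv.fderivWithin hU (m := 1) (by norm_num)).differentiableOn (by simp)) x hx
  have hB2 := LapData.differentiableAt_fderiv hB.smooth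
  set H : Euc d →L[ℝ] Euc d →L[ℝ] ℝ :=
    fderiv ℝ (fderiv ℝ B) x - fderivWithin ℝ (fderivWithin ℝ v X) X x with hHdef
  have hH : HasFDerivWithinAt T H X x :=
    hB2.hasFDerivAt.hasFDerivWithinAt.fun_sub hv2.hasFDerivWithinAt
  have key : ∀ e : Euc d, (‖x‖ = K * x 0 → inner ℝ ν e < 0) →
      T x e ≤ 0 ∧ (T x e = 0 → H e e ≤ 0) := fun e he =>
    second_order_conditions hx hT hH hmax (eventually_add_smul_mem_coneEnd hK hL hx he)
  have hTν : T x ν = 0 := by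
    rcases hx.1.lt_or_eq with hlt | heq
    · have h1 := (key ν fun h => absurd h hlt.ne).1
      have h2 := (key (-ν) fun h => absurd h hlt.ne).1
      rw [map_neg] at h2
      linarith
    · have h1 := (key (-ν) fun _ => by rw [inner_neg_right]; linarith).1
      have h2 : T x ν ≤ 0 := by
        have := hG heq
        simp only [hTdef, sub_apply, hneu heq, hB.grad]
        linarith
      rw [map_neg] at h1
      linarith
  have hT0le : ∀ e, T x e ≤ 0 := by
    intro e
    have h1 := (key (e - ((|inner ℝ ν e| + 1) / inner ℝ ν ν) • ν) fun _ => by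
      rw [inner_sub_right, inner_smul_right, div_mul_cancel₀ _ hν1.ne']
      linarith [le_abs_self (inner ℝ ν e)]).1
    rw [map_sub, map_smul, hTν] at h1
    simpa using h1
  have hT0 : ∀ e, T x e = 0 := fun e => le_antisymm (hT0le e) (by
    have := hT0le (-e)
    rw [map_neg] at this
    linarith)
  have hHi : ∀ e, H e e ≤ 0 := by
    have aux : ∀ e, inner ℝ ν e ≤ 0 → H e e ≤ 0 := by
      intro e he
      have hc : Continuous fun ε : ℝ => H (e - ε • ν) (e - ε • ν) := by fun_prop
      have hlim : Tendsto (fun ε : ℝ => H (e - ε • ν) (e - ε • ν)) (𝓝[>] 0) (𝓝 (H e e)) := by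
        simpa using (hc.tendsto 0).mono_left nhdsWithin_le_nhds
      refine le_of_tendsto hlim ?_
      filter_upwards [self_mem_nhdsWithin] with ε hε
      have hε' : (0 : ℝ) < ε := hε
      refine (key _ fun _ => ?_).2 (hT0 _)
      rw [inner_sub_right, inner_smul_right]
      nlinarith
    intro e
    rcases le_total (inner ℝ ν e) 0 with h | h
    · exact aux e h
    · have := aux (-e) (by rw [inner_neg_right]; linarith)
      simpa using this
  rw [← hB.lap, lapW, ← sub_nonpos, ← Finset.sum_sub_distrib]
  refine Finset.sum_nonpos fun i _ => ?_
  have h1 : fderiv ℝ (fun y => fderiv ℝ B y (EuclideanSpace.single i 1)) x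
      (EuclideanSpace.single i 1) = fderiv ℝ (fderiv ℝ B) x (EuclideanSpace.single i 1)
        (EuclideanSpace.single i 1) := by
    rw [fderiv_clm_apply hB2 (differentiableAt_const _)]
    simp
  have h2 : fderivWithin ℝ (fun y => fderivWithin ℝ v X y (EuclideanSpace.single i 1)) X x
      (EuclideanSpace.single i 1) = fderivWithin ℝ (fderivWithin ℝ v X) X x
        (EuclideanSpace.single i 1) (EuclideanSpace.single i 1) := by
    rw [fderivWithin_clm_apply (hU x hx) hv2 (differentiableWithinAt_const _)]
    simp
  rw [h1, h2]
  exact hHi (EuclideanSpace.single i 1)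

/-! ### The comparison principle under one-sided semicontinuity -/

/-- Joint lower semicontinuity of `u` at `(t₀, x₀)` when `(t₀, x₀)` is approached from later
times. -/
def RightLSCAt {E : Type*} [PseudoMetricSpace E] (X : Set E) (u : ℝ → E → ℝ) (t₀ : ℝ) (x₀ : E) :
    Prop :=
  ∀ ε > 0, ∃ ρ > 0, ∀ t, t₀ ≤ t → t < t₀ + ρ → ∀ x ∈ X, dist x x₀ < ρ → u t₀ x₀ - ε < u t x

theorem ConeSol.lt_of_barrier {d : ℕ} {K L : ℝ} {f : ℝ → ℝ} {u : ℝ → Euc d → ℝ}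
    (hu : ConeSol d K L f u) {Q : Set (Euc d)} (hQ : IsCompact Q) (hQX : Q ⊆ coneEnd d K L)
    {a b : ℝ} {B : ℝ → Euc d → ℝ}
    (hBc : ContinuousOn (fun p : ℝ × Euc d => B p.1 p.2) (Icc a b ×ˢ Q))
    (hlsc : ∀ t ∈ Icc a b, ∀ x ∈ Q, RightLSCAt (coneEnd d K L) u t x)
    (hinit : ∀ x ∈ Q, B a x < u a x)
    (hstep : ∀ t ∈ Ioc a b, ∀ x ∈ Q, B t x = u t x →
      (∀ᶠ y in 𝓝[coneEnd d K L] x, y ∈ Q) ∧ ∃ Bt l : ℝ, ∃ G : Euc d →L[ℝ] ℝ,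
        HasDerivAt (fun s => B s x) Bt t ∧ LapData (B t) x G l ∧
        (‖x‖ = K * x 0 → G (outward K x) ≤ 0) ∧ Bt < l + f (u t x)) :
    ∀ t ∈ Icc a b, ∀ x ∈ Q, B t x < u t x := by
  by_contra! hcon
  obtain ⟨t₁, ht₁, x₁, hx₁, hle₁⟩ := hcon
  set S : Set ℝ := {t | t ∈ Icc a b ∧ ∃ x ∈ Q, u t x ≤ B t x} with hS
  have hSne : S.Nonempty := ⟨t₁, ht₁, x₁, hx₁, hle₁⟩
  have hSbdd : BddBelow S := ⟨a, fun t ht => ht.1.1⟩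
  set ts := sInf S with hts
  obtain ⟨τ, -, hτlim, hτS⟩ := exists_seq_tendsto_sInf hSne hSbdd
  have hτge : ∀ n, ts ≤ τ n := fun n => csInf_le hSbdd (hτS n)
  have htsI : ts ∈ Icc a b := isClosed_Icc.mem_of_tendsto hτlim (Eventually.of_forall fun n => (hτS n).1)
  choose xs hxsQ hxs using fun n => (hτS n).2
  obtain ⟨x, hxQ, ψ, hψ, hxlim⟩ := hQ.tendsto_subseq hxsQ
  have hτlim' : Tendsto (fun n => τ (ψ n)) atTop (𝓝 ts) := hτlim.comp hψ.tendsto_atTop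
  have hge : u ts x ≤ B ts x := by
    refine le_of_forall_pos_lt_add fun ε hε => ?_
    obtain ⟨ρ, hρ, hlow⟩ := hlsc ts htsI x hxQ (ε / 2) (by linarith)
    have hBlim : Tendsto (fun n => B (τ (ψ n)) (xs (ψ n))) atTop (𝓝 (B ts x)) := by
      have h1 : Tendsto (fun n => (τ (ψ n), xs (ψ n))) atTop (𝓝[Icc a b ×ˢ Q] (ts, x)) :=
        tendsto_nhdsWithin_iff.2 ⟨hτlim'.prodMk_nhds hxlim,
          Eventually.of_forall fun n => ⟨(hτS _).1, hxsQ _⟩⟩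
      exact (hBc (ts, x) ⟨htsI, hxQ⟩).tendsto.comp h1
    obtain ⟨n, h1, h2, h3⟩ := ((hBlim.eventually (gt_mem_nhds (show B ts x < B ts x + ε / 2 by
      linarith))).and ((hτlim'.eventually (gt_mem_nhds (show ts < ts + ρ by linarith))).and
      (hxlim.eventually (Metric.ball_mem_nhds x hρ)))).exists
    have h4 := hlow _ (hτge (ψ n)) h2 _ (hQX (hxsQ _)) h3
    have h5 := hxs (ψ n)
    linarith
  have hats : a < ts := by
    rcases htsI.1.eq_or_lt with h | h
    · have := hinit x hxQ
      rw [← h] at hge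
      linarith
    · exact h
  have hbefore : ∀ s, a ≤ s → s < ts → ∀ y ∈ Q, B s y < u s y := by
    intro s has hs y hy
    by_contra! h
    exact absurd (csInf_le hSbdd (show s ∈ S from ⟨⟨has, hs.le.trans htsI.2⟩, y, hy, h⟩))
      (not_le.2 hs)
  have hleft : ∀ᶠ s in 𝓝[<] ts, s ∈ Ico a ts := Ico_mem_nhdsLT hats
  have hall : ∀ y ∈ Q, B ts y ≤ u ts y := by
    intro y hy
    have h1 : Tendsto (fun s => B s y) (𝓝[<] ts) (𝓝 (B ts y)) := by
      have h2 : Tendsto (fun s : ℝ => (s, y)) (𝓝[<] ts) (𝓝[Icc a b ×ˢ Q] (ts, y)) := by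
        refine tendsto_nhdsWithin_iff.2 ⟨?_, ?_⟩
        · exact (tendsto_id.mono_left nhdsWithin_le_nhds).prodMk_nhds tendsto_const_nhds
        · filter_upwards [hleft] with s hs
          exact ⟨⟨hs.1, hs.2.le.trans htsI.2⟩, hy⟩
      exact (hBc (ts, y) ⟨htsI, hy⟩).tendsto.comp h2
    have h3 : Tendsto (fun s => u s y) (𝓝[<] ts) (𝓝 (u ts y)) :=
      ((hu.time_diff y (hQX hy)).continuous.tendsto ts).mono_left nhdsWithin_le_nhds
    refine le_of_tendsto_of_tendsto h1 h3 ?_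
    filter_upwards [hleft] with s hs
    exact (hbefore s hs.1 hs.2 y hy).le
  have heq : B ts x = u ts x := le_antisymm (hall x hxQ) hge
  obtain ⟨hnear, Bt, l, G, hBt, hlap, hG, hlt⟩ := hstep ts ⟨hats, htsI.2⟩ x hxQ heq
  have hxX := hQX hxQ
  have h1 : l ≤ lapW (coneEnd d K L) (u ts) x := by
    refine lap_le_of_touching hu.one_lt hu.L_pos (hu.space_reg ts) hxX (hu.neumann ts x hxX)
      hlap hG ?_
    filter_upwards [hnear] with y hy
    have := hall y hy
    rw [heq]
    linarith
  have h2 := hu.pde ts x hxX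
  have h3 : deriv (fun s => u s x) ts ≤ Bt := by
    have hd : HasDerivWithinAt (fun s => B s x - u s x) (Bt - deriv (fun s => u s x) ts)
        (Iio ts) ts := (hBt.sub (hu.time_diff x hxX ts).hasDerivAt).hasDerivWithinAt
    rw [hasDerivWithinAt_iff_tendsto_slope' (by simp)] at hd
    have : 0 ≤ Bt - deriv (fun s => u s x) ts := by
      refine ge_of_tendsto hd ?_
      filter_upwards [hleft] with s hs
      have h4 := hbefore s hs.1 hs.2 x hxQ
      simp only [slope, vsub_eq_sub, heq, sub_self, sub_zero, smul_eq_mul]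
      exact mul_nonneg_of_nonpos_of_nonpos (inv_nonpos.2 (by linarith [hs.2])) (by linarith)
    linarith
  linarith

/-! ### From separate regularity to one-sided joint semicontinuity -/

/-- The set of points of `W` where `u` satisfies, at scale `1/(n+1)`, a Lipschitz bound with
constant `n` both in time and in space (within `V`). -/
def lipSet {E : Type*} [PseudoMetricSpace E] (V : Set E) (W : Set (ℝ × E)) (u : ℝ → E → ℝ)
    (n : ℕ) : Set (ℝ × E) :=
  {p | p ∈ W ∧ (∀ s, |s - p.1| < 1 / (n + 1) → |u s p.2 - u p.1 p.2| ≤ n * |s - p.1|) ∧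
    ∀ y ∈ V, dist y p.2 < 1 / (n + 1) → |u p.1 y - u p.1 p.2| ≤ n * dist y p.2}

theorem isClosed_lipSet {E : Type*} [PseudoMetricSpace E] {V : Set E} {W : Set (ℝ × E)}
    {u : ℝ → E → ℝ} (hW : IsClosed W) (hWV : ∀ p ∈ W, p.2 ∈ V)
    (ht : ∀ x ∈ V, Continuous fun t => u t x) (hx : ∀ t, ContinuousOn (u t) V) (n : ℕ) :
    IsClosed (lipSet V W u n) := by
  refine IsSeqClosed.isClosed fun q p hq hlim => ?_
  have hpW : p ∈ W := hW.mem_of_tendsto hlim (Eventually.of_forall fun k => (hq k).1)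
  have h1 : Tendsto (fun k => (q k).1) atTop (𝓝 p.1) := (continuous_fst.tendsto p).comp hlim
  have h2 : Tendsto (fun k => (q k).2) atTop (𝓝[V] p.2) :=
    tendsto_nhdsWithin_iff.2 ⟨(continuous_snd.tendsto p).comp hlim,
      Eventually.of_forall fun k => hWV _ (hq k).1⟩
  have hsp : ∀ s, Tendsto (fun k => u s (q k).2) atTop (𝓝 (u s p.2)) := fun s =>
    ((hx s) p.2 (hWV p hpW)).tendsto.comp h2
  have hpos : (0 : ℝ) < 1 / (n + 1) := by positivity
  have hdist : ∀ s : ℝ, Tendsto (fun k => |s - (q k).1|) atTop (𝓝 |s - p.1|) := fun s =>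
    (tendsto_const_nhds.sub h1).abs
  have hjoint : Tendsto (fun k => u (q k).1 (q k).2) atTop (𝓝 (u p.1 p.2)) := by
    have h3 : Tendsto (fun k => u p.1 (q k).2 - u (q k).1 (q k).2) atTop (𝓝 0) := by
      refine squeeze_zero_norm' (a := fun k => n * |p.1 - (q k).1|) ?_ ?_
      · have h4 : ∀ᶠ k in atTop, |p.1 - (q k).1| < 1 / (n + 1) :=
          (hdist p.1).eventually (gt_mem_nhds (by simpa using hpos))
        filter_upwards [h4] with k hk
        exact (hq k).2.1 p.1 hk
      · simpa using (hdist p.1).const_mul (n : ℝ)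
    simpa using (hsp p.1).sub h3
  refine ⟨hpW, fun s hs => ?_, fun y hy hyd => ?_⟩
  · refine le_of_tendsto_of_tendsto ((hsp s).sub hjoint).abs ((hdist s).const_mul (n : ℝ)) ?_
    filter_upwards [(hdist s).eventually (gt_mem_nhds hs)] with k hk
    exact (hq k).2.1 s hk
  · have hd : Tendsto (fun k => dist y (q k).2) atTop (𝓝 (dist y p.2)) :=
      tendsto_const_nhds.dist (h2.mono_right nhdsWithin_le_nhds)
    have hty : Tendsto (fun k => u (q k).1 y) atTop (𝓝 (u p.1 y)) := ((ht y hy).tendsto _).comp h1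
    refine le_of_tendsto_of_tendsto (hty.sub hjoint).abs (hd.const_mul (n : ℝ)) ?_
    filter_upwards [hd.eventually (gt_mem_nhds hyd)] with k hk
    exact (hq k).2.2 y hy hk

/-- Lower bounds propagate forward in time near `x₀`, uniformly with respect to the time interval,
as long as `u` is one-sidedly lower semicontinuous after the initial time. -/
def ForwardBound {E : Type*} [PseudoMetricSpace E] (X : Set E) (u : ℝ → E → ℝ) (x₀ : E) : Prop :=
  ∃ R₀ > 0, ∀ r, 0 < r → r < R₀ → ∃ A : ℝ, ∀ a b m : ℝ, a < b →
    (∀ t ∈ Ioc a b, ∀ x ∈ Metric.closedBall x₀ r ∩ X, RightLSCAt X u t x) →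
    (∀ x ∈ Metric.closedBall x₀ r ∩ X, m ≤ u a x) →
    ∀ t ∈ Ioc a b, ∀ z ∈ Metric.closedBall x₀ r ∩ X,
      m - dist z x₀ ^ 2 / r ^ 2 - A * (t - a) ≤ u t z

theorem rightLSCAt_of_forwardBound {E : Type*} [MetricSpace E] [CompleteSpace E] {X Y : Set E}
    {u : ℝ → E → ℝ} (hYX : Y ⊆ X)
    (hloc : ∀ x ∈ Y, ∃ R > 0, IsCompact (Metric.closedBall x R ∩ X) ∧
      Metric.closedBall x R ∩ X ⊆ Y)
    (ht : ∀ x ∈ Y, Differentiable ℝ fun t => u t x) (hx : ∀ t, ContinuousOn (u t) X)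
    (hlip : ∀ t, ∀ x ∈ Y, ∃ C : ℝ, ∀ᶠ y in 𝓝[X] x, |u t y - u t x| ≤ C * dist y x)
    (hfwd : ∀ x ∈ Y, ForwardBound X u x) :
    ∀ t, ∀ x ∈ Y, RightLSCAt X u t x := by
  by_contra! hcon
  obtain ⟨t₁, x₁, hx₁, hbad⟩ := hcon
  obtain ⟨R, hR, hVc, hVY⟩ := hloc x₁ hx₁
  set V := Metric.closedBall x₁ R ∩ X with hV
  set W : Set (ℝ × E) := Icc (t₁ - 1) (t₁ + 1) ×ˢ V with hW
  have hWc : IsCompact W := isCompact_Icc.prod hVc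
  set B : Set (ℝ × E) := {p | (p.1 ∈ Ioo (t₁ - 1) (t₁ + 1) ∧ p.2 ∈ Metric.ball x₁ R ∧ p.2 ∈ X) ∧
    ¬ RightLSCAt X u p.1 p.2} with hB
  have hBW : B ⊆ W := by
    rintro p ⟨⟨h1, h2, h3⟩, -⟩
    exact ⟨Ioo_subset_Icc_self h1, Metric.ball_subset_closedBall h2, h3⟩
  set F := closure B with hF
  have hFW : F ⊆ W := closure_minimal hBW hWc.isClosed
  have hBne : (t₁, x₁) ∈ B :=
    ⟨⟨⟨by simp, by simp⟩, Metric.mem_ball_self hR, hYX hx₁⟩, hbad⟩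
  have hVx : ∀ t, ContinuousOn (u t) V := fun t => (hx t).mono inter_subset_right
  have hclosed : ∀ n, IsClosed (lipSet V W u n) := isClosed_lipSet hWc.isClosed (fun p hp => hp.2)
    (fun x hx => (ht x (hVY hx)).continuous) hVx
  have hcover : ∀ p ∈ W, ∃ n : ℕ, p ∈ lipSet V W u n := by
    rintro ⟨t, x⟩ hp
    have hxY : x ∈ Y := hVY hp.2
    obtain ⟨C, hC⟩ := hlip t x hxY
    obtain ⟨ρ, hρ, hCρ⟩ := Metric.mem_nhdsWithin_iff.1 hC
    obtain ⟨C', hC'⟩ := ((ht x hxY) t).isBigO_sub.bound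
    obtain ⟨ρ', hρ', hCρ'⟩ := Metric.mem_nhds_iff.1 hC'
    obtain ⟨n, hn⟩ := exists_nat_gt (max (max C C') (max (1 / ρ) (1 / ρ')))
    obtain ⟨⟨hn1, hn2⟩, hn3, hn4⟩ : (C < n ∧ C' < n) ∧ 1 / ρ < n ∧ 1 / ρ' < n := by
      simpa only [max_lt_iff] using hn
    have hscale : ∀ ρ : ℝ, 0 < ρ → 1 / ρ < n → 1 / ((n : ℝ) + 1) < ρ := by
      intro ρ hρ hn
      rw [div_lt_iff₀ (by positivity)]
      rw [div_lt_iff₀ hρ] at hn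
      nlinarith
    refine ⟨n, hp, fun s hs => ?_, fun y hy hyd => ?_⟩
    · have h1 : s ∈ Metric.ball t ρ' := hs.trans (hscale ρ' hρ' hn4)
      have h2 : ‖u s x - u t x‖ ≤ C' * ‖s - t‖ := hCρ' h1
      exact h2.trans (mul_le_mul_of_nonneg_right hn2.le (norm_nonneg _))
    · have h1 : y ∈ Metric.ball x ρ ∩ X := ⟨hyd.trans (hscale ρ hρ hn3), hy.2⟩
      have h2 : |u t y - u t x| ≤ C * dist y x := hCρ h1
      exact h2.trans (mul_le_mul_of_nonneg_right hn1.le dist_nonneg)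
  have hFc : IsClosed F := isClosed_closure
  have : CompleteSpace F := hFc.completeSpace_coe
  have : Nonempty F := ⟨⟨(t₁, x₁), subset_closure hBne⟩⟩
  obtain ⟨n, ⟨⟨q, hqF⟩, hq⟩⟩ := nonempty_interior_of_iUnion_of_closed
    (f := fun n => ((↑) : F → ℝ × E) ⁻¹' lipSet V W u n)
    (fun n => (hclosed n).preimage continuous_subtype_val)
    (by
      refine eq_univ_of_forall fun p => mem_iUnion.2 ?_
      exact hcover p (hFW p.2))
  rw [mem_interior_iff_mem_nhds, nhds_subtype_eq_comap] at hq
  obtain ⟨P, hP, hPF⟩ := mem_comap.1 hq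
  obtain ⟨P', hP'P, hP'o, hqP'⟩ := mem_nhds_iff.1 hP
  obtain ⟨⟨t₀, x₀⟩, hpP', hpB⟩ := mem_closure_iff.1 hqF P' hP'o hqP'
  have hsub : ∀ p ∈ P', p ∈ F → p ∈ lipSet V W u n := fun p hp hpF =>
    hPF (show (⟨p, hpF⟩ : F) ∈ ((↑) : F → ℝ × E) ⁻¹' P from hP'P hp)
  obtain ⟨ρ₀, hρ₀, hρP⟩ := Metric.isOpen_iff.1 hP'o _ hpP'
  have hp0 := hsub _ hpP' (subset_closure hpB)
  obtain ⟨⟨ht₀, hx₀R, hx₀X⟩, hnot⟩ := hpB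
  simp only at ht₀ hx₀R hx₀X hnot
  refine hnot fun ε hε => ?_
  have hx₀Y : x₀ ∈ Y := hVY ⟨Metric.ball_subset_closedBall hx₀R, hx₀X⟩
  obtain ⟨R₀, hR₀, hR₀b⟩ := hfwd x₀ hx₀Y
  have hxd : 0 < R - dist x₀ x₁ := sub_pos.2 hx₀R
  have hn1 : (0 : ℝ) < 1 / (n + 1) := by positivity
  have hn0 : (0 : ℝ) ≤ n := Nat.cast_nonneg n
  obtain ⟨r, hr, hrs⟩ : ∃ r > 0, r < min (min R₀ ρ₀) (min (R - dist x₀ x₁)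
      (min (1 / (n + 1) / 2) (ε / (12 * (n + 1))))) :=
    exists_between (by positivity)
  simp only [lt_min_iff] at hrs
  obtain ⟨⟨hrR₀, hrρ₀⟩, hrR, hrn, hrε⟩ := hrs
  obtain ⟨A, hA⟩ := hR₀b r hr hrR₀
  have hrε' : 3 * n * r < ε / 4 := by
    rw [lt_div_iff₀ (by positivity)] at hrε
    nlinarith
  have htl : 0 < t₁ + 1 - t₀ := by linarith [ht₀.2]
  obtain ⟨η, hη, hηs⟩ : ∃ η > 0, η < min (min ρ₀ (1 / (n + 1))) (min (t₁ + 1 - t₀)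
      (min (ε / (4 * (n + 1))) (ε / (4 * (|A| + 1))))) :=
    exists_between (by positivity)
  simp only [lt_min_iff] at hηs
  obtain ⟨⟨hηρ₀, hηn⟩, hηt, hηε, hηA⟩ := hηs
  have hηε' : n * η < ε / 4 := by
    rw [lt_div_iff₀ (by positivity)] at hηε
    nlinarith
  have hηA' : |A| * η < ε / 4 := by
    rw [lt_div_iff₀ (by positivity)] at hηA
    nlinarith [abs_nonneg A]
  set D := Metric.closedBall x₀ r ∩ X with hD
  have hDball : D ⊆ Metric.ball x₁ R := fun y hy => by
    have h1 : dist y x₀ ≤ r := hy.1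
    have := dist_triangle y x₀ x₁
    rw [Metric.mem_ball]
    linarith
  have hDV : D ⊆ V := fun y hy => ⟨Metric.ball_subset_closedBall (hDball hy), hy.2⟩
  have hDc : IsCompact D := by
    have : D = V ∩ Metric.closedBall x₀ r := by
      ext y
      exact ⟨fun hy => ⟨hDV hy, hy.1⟩, fun hy => ⟨hy.2, hy.1.2⟩⟩
    rw [this]
    exact hVc.inter_right Metric.isClosed_closedBall
  have hgoodF : ∀ t ∈ Icc t₀ (t₀ + η), ∀ y ∈ D, (t, y) ∉ F → RightLSCAt X u t y := by
    intro t ht y hy hyF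
    by_contra hbad
    exact hyF (subset_closure ⟨⟨⟨by linarith [ht.1, ht₀.1], by linarith [ht.2]⟩, hDball hy, hy.2⟩,
      hbad⟩)
  have hbadtime : ∀ t ∈ Icc t₀ (t₀ + η), (∃ y ∈ D, (t, y) ∈ F) →
      ∀ z ∈ D, u t₀ x₀ - ε / 2 ≤ u t z := by
    rintro t ht ⟨y, hyD, hyF⟩ z hz
    have hy0 : dist y x₀ ≤ r := hyD.1
    have hz0 : dist z x₀ ≤ r := hz.1
    have habs : |t₀ - t| ≤ η := by rw [abs_le]; constructor <;> linarith [ht.1, ht.2]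
    have hyl : (t, y) ∈ lipSet V W u n := by
      refine hsub _ (hρP ?_) hyF
      rw [Metric.mem_ball, Prod.dist_eq, max_lt_iff]
      refine ⟨?_, lt_of_le_of_lt hy0 hrρ₀⟩
      rw [dist_comm, Real.dist_eq]
      exact lt_of_le_of_lt habs hηρ₀
    have hzy : dist z y ≤ 2 * r := by
      have := dist_triangle_right z y x₀
      linarith
    have h1 := hyl.2.2 z (hDV hz) (by simp only; linarith)
    have h2 := hyl.2.1 t₀ (lt_of_le_of_lt habs hηn)
    have h3 := hp0.2.2 y (hDV hyD) (by simp only; linarith)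
    simp only at h1 h2 h3
    have h1' := (abs_le.1 h1).1
    have h2' := (abs_le.1 h2).2
    have h3' := (abs_le.1 h3).1
    nlinarith [mul_le_mul_of_nonneg_left hzy hn0, mul_le_mul_of_nonneg_left habs hn0,
      mul_le_mul_of_nonneg_left hy0 hn0]
  refine ⟨min η (r * min 1 (ε / 8)), by positivity, fun t htl htr z hz hzd => ?_⟩
  rw [lt_min_iff] at hzd
  have htη : t ∈ Icc t₀ (t₀ + η) := ⟨htl, by linarith [min_le_left η (r * min 1 (ε / 8))]⟩
  have hzr : dist z x₀ ≤ r := hzd.2.le.trans (by nlinarith [min_le_left 1 (ε / 8)])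
  have hzD : z ∈ D := ⟨hzr, hz⟩
  by_cases hS : ∃ y ∈ D, (t, y) ∈ F
  · linarith [hbadtime t htη hS z hzD]
  · set S : Set ℝ := Prod.fst '' (F ∩ Icc t₀ t ×ˢ D) with hSdef
    have hSc : IsCompact S :=
      ((isCompact_Icc.prod hDc).inter_left hFc).image continuous_fst
    have hx₀D : x₀ ∈ D := ⟨Metric.mem_closedBall_self hr.le, hx₀X⟩
    have hSne : S.Nonempty := ⟨t₀, (t₀, x₀), ⟨subset_closure ⟨⟨ht₀, hx₀R, hx₀X⟩, hnot⟩,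
      ⟨le_rfl, htl⟩, hx₀D⟩, rfl⟩
    obtain ⟨a, ⟨⟨a', y⟩, ⟨hyF, hat, hyD⟩, rfl⟩, hmaxa⟩ := hSc.exists_isGreatest hSne
    simp only at hat hyD hmaxa
    have hlt : a' < t := by
      refine lt_of_le_of_ne hat.2 fun h => hS ⟨y, hyD, ?_⟩
      rwa [← h]
    have haη : a' ∈ Icc t₀ (t₀ + η) := ⟨hat.1, hat.2.trans htη.2⟩
    have hkey := hA a' t (u t₀ x₀ - ε / 2) hlt
      (by
        intro s hs x hxD
        refine hgoodF s ⟨hat.1.trans hs.1.le, hs.2.trans htη.2⟩ x hxD fun hsF => ?_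
        have := hmaxa ⟨(s, x), ⟨hsF, ⟨hat.1.trans hs.1.le, hs.2⟩, hxD⟩, rfl⟩
        exact absurd this (not_le.2 hs.1))
      (fun x hxD => hbadtime a' haη ⟨y, hyD, hyF⟩ x hxD) t ⟨hlt, le_rfl⟩ z hzD
    have h5 : dist z x₀ ^ 2 / r ^ 2 ≤ ε / 8 := by
      rw [div_le_iff₀ (by positivity)]
      have hm1 := min_le_left 1 (ε / 8)
      have hm2 := min_le_right 1 (ε / 8)
      have hm0 : 0 < min 1 (ε / 8) := by positivity
      calc dist z x₀ ^ 2 ≤ (r * min 1 (ε / 8)) ^ 2 := by gcongr; exact hzd.2.le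
        _ = r ^ 2 * (min 1 (ε / 8) * min 1 (ε / 8)) := by ring
        _ ≤ r ^ 2 * (1 * (ε / 8)) := by gcongr
        _ = ε / 8 * r ^ 2 := by ring
    have h6 : A * (t - a') ≤ |A| * η := by
      have : t - a' ≤ η := by linarith [htη.2, hat.1]
      calc A * (t - a') ≤ |A| * (t - a') :=
            mul_le_mul_of_nonneg_right (le_abs_self A) (by linarith)
        _ ≤ |A| * η := by gcongr
    linarith

/-! ### Explicit barriers -/

theorem sum_innerSL_single_sq {d : ℕ} (w : Euc d) :
    ∑ i, (innerSL ℝ w (EuclideanSpace.single i 1)) ^ 2 = ‖w‖ ^ 2 := by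
  simp [EuclideanSpace.inner_single_right, EuclideanSpace.real_norm_sq_eq]

namespace LapData

theorem comp_of_hasDerivAt {d : ℕ} {B : Euc d → ℝ} {x : Euc d} {G : Euc d →L[ℝ] ℝ} {l : ℝ}
    (h : LapData B x G l) {Ψ Ψ' : ℝ → ℝ} {p : ℝ} (hΨ : ContDiffAt ℝ 2 Ψ (B x))
    (h1 : ∀ᶠ z in 𝓝 (B x), HasDerivAt Ψ (Ψ' z) z) (h2 : HasDerivAt Ψ' p (B x)) :
    LapData (fun y => Ψ (B y)) x (Ψ' (B x) • G)
      (p * ∑ i, G (EuclideanSpace.single i 1) ^ 2 + Ψ' (B x) * l) := by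
  have h3 : deriv Ψ =ᶠ[𝓝 (B x)] Ψ' := h1.mono fun z hz => hz.deriv
  have h4 := h.comp hΨ
  rwa [h3.deriv_eq, h2.deriv, h3.eq_of_nhds] at h4

theorem of_coord {d : ℕ} (i : Fin (d + 1)) (x : Euc d) :
    LapData (fun y => y i) x (EuclideanSpace.proj i) 0 := by
  have h : ∀ y : Euc d, fderiv ℝ (fun y : Euc d => y i) y = EuclideanSpace.proj i := fun y =>
    (EuclideanSpace.proj i : Euc d →L[ℝ] ℝ).hasFDerivAt.fderiv
  exact ⟨by fun_prop, h x, by simp [h]⟩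

theorem of_coord_sub_sq {d : ℕ} (i : Fin (d + 1)) (c : ℝ) (x : Euc d) :
    LapData (fun y => (y i - c) ^ 2) x ((2 * (x i - c)) • EuclideanSpace.proj i) 2 := by
  have h := (of_coord i x).comp_of_hasDerivAt (Ψ := fun z => (z - c) ^ 2)
    (Ψ' := fun z => 2 * (z - c)) (p := 2) (by fun_prop)
    (Eventually.of_forall fun z => by
      simpa using ((hasDerivAt_id' z).sub_const c).fun_pow 2)
    (by simpa using ((hasDerivAt_id' (x i)).sub_const c).const_mul 2)
  refine h.congr rfl ?_
  simp [PiLp.single_apply]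

theorem of_norm_sub_sq {d : ℕ} (c x : Euc d) :
    LapData (fun y => ‖y - c‖ ^ 2) x ((2 : ℝ) • innerSL ℝ (x - c)) (2 * (d + 1)) := by
  have h := LapData.sum (s := Finset.univ) fun i _ => of_coord_sub_sq i (c i) x
  have he : (fun y : Euc d => ‖y - c‖ ^ 2) = fun y => ∑ i, (y i - c i) ^ 2 := by
    ext y
    simp [EuclideanSpace.real_norm_sq_eq]
  rw [he]
  refine h.congr ?_ ?_
  · ext v
    simp only [sum_apply, smul_apply, innerSL_apply_apply, PiLp.inner_apply, smul_eq_mul,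
      Finset.mul_sum, PiLp.proj_apply, PiLp.sub_apply]
    refine Finset.sum_congr rfl fun i _ => ?_
    simp
    ring
  · simp [mul_comm]

theorem of_norm {d : ℕ} {x : Euc d} (hx : x ≠ 0) :
    LapData (fun y => ‖y‖) x (‖x‖⁻¹ • innerSL ℝ x) (d / ‖x‖) := by
  have hr : 0 < ‖x‖ := norm_pos_iff.2 hx
  have h := of_norm_sub_sq 0 x
  simp only [sub_zero] at h
  have hq : 0 < ‖x‖ ^ 2 := by positivity
  have h1 := h.comp_of_hasDerivAt (Ψ := Real.sqrt) (Ψ' := fun z => 1 / (2 * Real.sqrt z))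
    (Real.contDiffAt_sqrt hq.ne')
    ((lt_mem_nhds hq).mono fun z hz => Real.hasDerivAt_sqrt (ne_of_gt hz))
    ((hasDerivAt_const _ (1 : ℝ)).div ((Real.hasDerivAt_sqrt hq.ne').const_mul 2)
      (by positivity))
  simp only [Real.sqrt_sq (norm_nonneg _)] at h1
  refine h1.congr ?_ ?_
  · rw [smul_smul]
    congr 1
    field_simp
  · simp only [smul_apply, smul_eq_mul, mul_pow, ← Finset.mul_sum, sum_innerSL_single_sq]
    field_simp
    ring

end LapData

/-- The quadratic form vanishing on the lateral boundary of the cone `‖x‖ ≤ K x₁`. -/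
def coneDefect {d : ℕ} (K : ℝ) (x : Euc d) : ℝ := K ^ 2 * x 0 ^ 2 - ‖x‖ ^ 2

theorem lapData_coneDefect {d : ℕ} (K : ℝ) (x : Euc d) :
    LapData (coneDefect K) x ((-2 : ℝ) • innerSL ℝ (outward K x)) (2 * K ^ 2 - 2 * (d + 1)) := by
  have h := ((LapData.of_coord_sub_sq 0 0 x).const_mul (K ^ 2)).add
    ((LapData.of_norm_sub_sq 0 x).const_mul (-1))
  simp only [sub_zero] at h
  have he : coneDefect K = fun y : Euc d => K ^ 2 * y 0 ^ 2 + -1 * ‖y‖ ^ 2 := by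
    ext y
    simp [coneDefect, sub_eq_add_neg]
  rw [he]
  refine h.congr ?_ (by ring)
  ext v
  simp only [add_apply, smul_apply, innerSL_apply_apply, inner_outward, smul_eq_mul,
    PiLp.proj_apply]
  ring

/-- A multiple of the heat kernel `T^{-κ} e^{-Φ/(4T)}`, with `T = s - a + ρ²`, normalised to be at
least one at time `s = a` where `Φ ≤ ρ²`. -/
def heatBump {d : ℕ} (κ ρ a : ℝ) (Φ : Euc d → ℝ) (s : ℝ) (x : Euc d) : ℝ :=
  Real.exp (1 / 4) * (ρ ^ 2 / (s - a + ρ ^ 2)) ^ κ * Real.exp (-Φ x / (4 * (s - a + ρ ^ 2)))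

theorem heatBump_nonneg {d : ℕ} (κ : ℝ) {ρ a s : ℝ} (hs : a ≤ s) (Φ : Euc d → ℝ) (x : Euc d) :
    0 ≤ heatBump κ ρ a Φ s x := by
  have : 0 ≤ s - a := by linarith
  unfold heatBump
  positivity

theorem one_le_heatBump {d : ℕ} (κ : ℝ) {ρ a : ℝ} (hρ : 0 < ρ) {Φ : Euc d → ℝ} {x : Euc d}
    (hx : Φ x ≤ ρ ^ 2) : 1 ≤ heatBump κ ρ a Φ a x := by
  have hρ2 : 0 < ρ ^ 2 := by positivity
  simp only [heatBump, sub_self, zero_add, div_self hρ2.ne', Real.one_rpow, mul_one]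
  rw [← Real.exp_add]
  refine Real.one_le_exp ?_
  have : Φ x / (4 * ρ ^ 2) ≤ 1 / 4 := by
    rw [div_le_div_iff₀ (by positivity) (by norm_num)]
    linarith
  rw [neg_div]
  linarith

theorem heatBump_le {d : ℕ} {κ ρ a s σ : ℝ} (hκ : 0 ≤ κ) (hσ : 0 < σ) (hs : a + σ ≤ s)
    {Φ : Euc d → ℝ} {x : Euc d} (hx : 0 ≤ Φ x) :
    heatBump κ ρ a Φ s x ≤ Real.exp (1 / 4) * (ρ ^ 2 / σ) ^ κ := by
  have hσs : σ ≤ s - a := by linarith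
  have hs' : 0 ≤ s - a := by linarith
  unfold heatBump
  have h1 : Real.exp (-Φ x / (4 * (s - a + ρ ^ 2))) ≤ 1 := by
    rw [Real.exp_le_one_iff]
    exact div_nonpos_of_nonpos_of_nonneg (by linarith) (by positivity)
  calc _ ≤ Real.exp (1 / 4) * (ρ ^ 2 / (s - a + ρ ^ 2)) ^ κ * 1 := by gcongr
    _ ≤ _ := by
      rw [mul_one]
      gcongr
      nlinarith [sq_nonneg ρ]

theorem continuousOn_heatBump {d : ℕ} (κ : ℝ) {ρ a : ℝ} (hρ : 0 < ρ) {Φ : Euc d → ℝ}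
    (hΦ : Continuous Φ) :
    ContinuousOn (fun p : ℝ × Euc d => heatBump κ ρ a Φ p.1 p.2) (Ici a ×ˢ univ) := by
  have hT : ∀ p ∈ Ici a ×ˢ (univ : Set (Euc d)), p.1 - a + ρ ^ 2 ≠ 0 := by
    intro p hp
    have : a ≤ p.1 := hp.1
    have h2 : 0 < ρ ^ 2 := by positivity
    exact ne_of_gt (by linarith)
  unfold heatBump
  refine (continuousOn_const.mul (ContinuousOn.rpow_const ?_ ?_)).mul ?_
  · exact continuousOn_const.div (by fun_prop) hT
  · intro p hp
    left
    have := hT p hp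
    positivity
  · refine Real.continuous_exp.comp_continuousOn (ContinuousOn.div (by fun_prop) (by fun_prop) ?_)
    intro p hp
    exact mul_ne_zero (by norm_num) (hT p hp)

theorem heatBump_supersolution {d : ℕ} {κ ρ a s : ℝ} (hρ : 0 < ρ) (hs : a ≤ s) {Φ : Euc d → ℝ}
    {x : Euc d} {G : Euc d →L[ℝ] ℝ} {l : ℝ} (hΦ : LapData Φ x G l)
    (hG : ∑ i, G (EuclideanSpace.single i 1) ^ 2 ≤ 4 * Φ x) (hl : 4 * κ ≤ l) :
    ∃ gt l' b : ℝ, HasDerivAt (fun s => heatBump κ ρ a Φ s x) gt s ∧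
      LapData (heatBump κ ρ a Φ s) x (b • G) l' ∧ l' ≤ gt := by
  set T := s - a + ρ ^ 2 with hT
  have hTpos : 0 < T := by
    have : 0 < ρ ^ 2 := by positivity
    linarith
  have hρ2 : 0 < ρ ^ 2 := by positivity
  set g := heatBump κ ρ a Φ s x with hg
  have hg0 : 0 ≤ g := heatBump_nonneg κ hs Φ x
  set C := Real.exp (1 / 4) * (ρ ^ 2 / T) ^ κ with hC
  refine ⟨g * (-κ / T + Φ x / (4 * T ^ 2)), _, _, ?_,
    hΦ.comp_of_hasDerivAt (Ψ := fun z => C * Real.exp (-z / (4 * T)))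
      (Ψ' := fun z => C * (Real.exp (-z / (4 * T)) * (-1 / (4 * T))))
      (p := C * (Real.exp (-Φ x / (4 * T)) * (-1 / (4 * T)) * (-1 / (4 * T))))
      (by fun_prop) (Eventually.of_forall fun z => ?_) ?_, ?_⟩
  · have hTd : HasDerivAt (fun s => s - a + ρ ^ 2) 1 s :=
      ((hasDerivAt_id s).sub_const a).add_const _
    have h1 := (((hasDerivAt_const s (ρ ^ 2)).div hTd hTpos.ne').rpow_const (p := κ)
      (Or.inl (div_pos hρ2 hTpos).ne')).const_mul (Real.exp (1 / 4))
    have h2 := (((hasDerivAt_const s (-Φ x)).div (hTd.const_mul 4) (by positivity))).exp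
    refine (h1.mul h2).congr_deriv ?_
    have hrp : (ρ ^ 2 / T) ^ (κ - 1) = (ρ ^ 2 / T) ^ κ * (T / ρ ^ 2) := by
      rw [Real.rpow_sub_one (by positivity)]
      field_simp
    simp only [← hT, Pi.div_apply, hrp, hg, heatBump]
    field_simp
    ring
  · exact (((hasDerivAt_id' z).fun_neg.div_const (4 * T)).exp).const_mul C
  · exact ((((hasDerivAt_id' (Φ x)).fun_neg.div_const (4 * T)).exp).mul_const (-1 / (4 * T))).const_mul C
  · have hgC : C * Real.exp (-Φ x / (4 * T)) = g := rfl
    have e1 : C * (Real.exp (-Φ x / (4 * T)) * (-1 / (4 * T)) * (-1 / (4 * T))) =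
        g * (1 / (16 * T ^ 2)) := by
      rw [← hgC]
      field_simp
      ring
    have e2 : C * (Real.exp (-Φ x / (4 * T)) * (-1 / (4 * T))) = g * (-1 / (4 * T)) := by
      rw [← hgC]
      ring
    rw [e2]
    rw [e1, mul_assoc, mul_assoc, ← mul_add]
    refine mul_le_mul_of_nonneg_left ?_ hg0
    have h3 : 1 / (16 * T ^ 2) * ∑ i, G (EuclideanSpace.single i 1) ^ 2 ≤
        1 / (16 * T ^ 2) * (4 * Φ x) := by gcongr
    have h4 : 1 / (4 * T) * (4 * κ) ≤ 1 / (4 * T) * l := by gcongr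
    have h5 : 1 / (16 * T ^ 2) * (4 * Φ x) = Φ x / (4 * T ^ 2) := by field_simp; ring
    have h6 : 1 / (4 * T) * (4 * κ) = κ / T := by field_simp
    have h7 : -1 / (4 * T) * l = - (1 / (4 * T) * l) := by ring
    have h8 : -κ / T = -(κ / T) := by ring
    linarith

/-! ### Forward propagation of lower bounds -/

/-- A nonnegative supersolution of the heat equation on `[a', t] × Q`, for some time `a'` between
`a` and `t`, which is at least one where `u` is below `m - ε` at time `a'` and which is at most `ε`
at time `t`. -/
def HasShield {d : ℕ} (K : ℝ) (u : ℝ → Euc d → ℝ) (Q : Set (Euc d)) (a t m ε : ℝ) : Prop :=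
  ∃ a' ∈ Ioo a t, ∃ g : ℝ → Euc d → ℝ,
    ContinuousOn (fun p : ℝ × Euc d => g p.1 p.2) (Icc a' t ×ˢ Q) ∧
    (∀ s ∈ Icc a' t, ∀ x ∈ Q, 0 ≤ g s x ∧ ∃ gt l : ℝ, ∃ G : Euc d →L[ℝ] ℝ,
      HasDerivAt (fun s => g s x) gt s ∧ LapData (g s) x G l ∧
      (‖x‖ = K * x 0 → 0 ≤ G (outward K x)) ∧ l ≤ gt) ∧
    (∀ x ∈ Q, u a' x ≤ m - ε → 1 ≤ g a' x) ∧ ∀ x ∈ Q, g t x ≤ ε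

theorem isCompact_closedBall_inter_coneEnd {d : ℕ} {K L r : ℝ} {x₀ : Euc d}
    (hball : Metric.closedBall x₀ r ⊆ {x | L < ‖x‖}) :
    IsCompact (Metric.closedBall x₀ r ∩ coneEnd d K L) := by
  have h : Metric.closedBall x₀ r ∩ coneEnd d K L =
      Metric.closedBall x₀ r ∩ {x | ‖x‖ ≤ K * x 0} := by
    ext x
    exact ⟨fun hx => ⟨hx.1, hx.2.1⟩, fun hx => ⟨hx.1, hx.2, hball hx.1⟩⟩
  rw [h]
  exact (isCompact_closedBall x₀ r).inter_right
    (isClosed_le continuous_norm (continuous_const.mul (continuous_coord 0)))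

theorem inner_outward_sub_nonneg {d : ℕ} {K : ℝ} {x x₀ : Euc d}
    (hx : ‖x‖ = K * x 0) (hx₀ : ‖x₀‖ ≤ K * x₀ 0) : 0 ≤ inner ℝ (outward K x) (x - x₀) := by
  rw [inner_outward, inner_sub_right, real_inner_self_eq_norm_sq, hx]
  simp only [PiLp.sub_apply]
  have h1 := real_inner_le_norm x x₀
  rw [hx] at h1
  have h2 : 0 ≤ K * x 0 := hx ▸ norm_nonneg x
  nlinarith [mul_le_mul_of_nonneg_left hx₀ h2]

theorem ConeSol.forwardBound_of_shield {d : ℕ} {K L : ℝ} {f : ℝ → ℝ} {u : ℝ → Euc d → ℝ}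
    (hu : ConeSol d K L f u) (hf : Continuous f) {x₀ : Euc d} (hx₀ : x₀ ∈ coneEnd d K L) {R₀ : ℝ}
    (hR₀ : 0 < R₀) (hball : Metric.closedBall x₀ R₀ ⊆ {x | L < ‖x‖})
    (hshield : ∀ r, 0 < r → r < R₀ → ∀ a b m : ℝ, a < b →
      (∀ x ∈ Metric.closedBall x₀ r ∩ coneEnd d K L, m ≤ u a x) → ∀ t ∈ Ioc a b, ∀ ε > 0,
        HasShield K u (Metric.closedBall x₀ r ∩ coneEnd d K L) a t m ε) :
    ForwardBound (coneEnd d K L) u x₀ := by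
  obtain ⟨F, hF⟩ : ∃ F : ℝ, ∀ s ∈ Icc (0 : ℝ) 1, -F ≤ f s := by
    obtain ⟨F, hF⟩ := isCompact_Icc.exists_bound_of_continuousOn (hf.continuousOn (s := Icc 0 1))
    exact ⟨F, fun s hs => (abs_le.1 (hF s hs)).1⟩
  refine ⟨R₀, hR₀, fun r hr hrR => ⟨2 * (d + 1) / r ^ 2 + |F| + 1, fun a b m hab hlsc hinit => ?_⟩⟩
  intro t ht z hz
  set X := coneEnd d K L with hX
  set Q := Metric.closedBall x₀ r ∩ X with hQ
  set A := 2 * ((d : ℝ) + 1) / r ^ 2 + |F| + 1 with hA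
  have hA0 : 0 ≤ A := by positivity
  have hx₀Q : x₀ ∈ Q := ⟨Metric.mem_closedBall_self hr.le, hx₀⟩
  have hm1 : m ≤ 1 := (hinit x₀ hx₀Q).trans (hu.range01 a x₀ hx₀).2
  have hQc : IsCompact Q := isCompact_closedBall_inter_coneEnd
    ((Metric.closedBall_subset_closedBall hrR.le).trans hball)
  refine le_of_forall_pos_le_add fun ε' hε' => ?_
  set ε := ε' / 2 with hε
  have hε0 : 0 < ε := by positivity
  obtain ⟨a', ha', g, hgc, hg, hg1, hgt⟩ := hshield r hr hrR a b m hab hinit t ht ε hε0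
  set B : ℝ → Euc d → ℝ := fun s x => m - ε - ‖x - x₀‖ ^ 2 / r ^ 2 - A * (s - a') - g s x with hB
  have hcomp : ∀ s ∈ Icc a' t, ∀ x ∈ Q, B s x < u s x := by
    refine hu.lt_of_barrier hQc inter_subset_right ?_ ?_ ?_ ?_
    · exact ContinuousOn.sub (Continuous.continuousOn (by fun_prop)) hgc
    · intro s hs x hx
      exact hlsc s ⟨ha'.1.trans_le hs.1, hs.2.trans ht.2⟩ x hx
    · intro x hx
      have h0 := (hg a' ⟨le_rfl, ha'.2.le⟩ x hx).1
      have h2 : 0 ≤ ‖x - x₀‖ ^ 2 / r ^ 2 := by positivity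
      have h3 := (hu.range01 a' x hx.2).1
      simp only [hB, sub_self, mul_zero, sub_zero]
      by_cases h : u a' x ≤ m - ε
      · have h4 := hg1 x hx h
        linarith
      · linarith [not_le.1 h]
    · intro s hs x hx heq
      obtain ⟨hg0, gt, l, G, hgt', hgl, hgG, hgle⟩ := hg s ⟨hs.1.le, hs.2⟩ x hx
      have hux := hu.range01 s x hx.2
      have hAs : 0 ≤ A * (s - a') := mul_nonneg hA0 (by linarith [hs.1])
      constructor
      · have hlt : dist x x₀ < r := by
          by_contra! hge
          have h1 : 1 ≤ ‖x - x₀‖ ^ 2 / r ^ 2 := by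
            rw [le_div_iff₀ (by positivity), ← dist_eq_norm]
            nlinarith
          have h2 : B s x < 0 := by
            simp only [hB]
            linarith
          linarith [hux.1]
        filter_upwards [nhdsWithin_le_nhds (Metric.isOpen_ball.mem_nhds hlt),
          self_mem_nhdsWithin] with y hy hyX
        exact ⟨Metric.ball_subset_closedBall hy, hyX⟩
      · refine ⟨-A - gt, -(2 * (d + 1) / r ^ 2) - l,
          (-1 / r ^ 2) • ((2 : ℝ) • innerSL ℝ (x - x₀)) + (-1 : ℝ) • G, ?_, ?_, ?_, ?_⟩
        · refine (((((hasDerivAt_id' s).sub_const a').const_mul A).const_sub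
            (m - ε - ‖x - x₀‖ ^ 2 / r ^ 2)).sub hgt').congr_deriv (by ring)
        · have h1 := ((LapData.const (m - ε - A * (s - a')) x).add
            ((LapData.of_norm_sub_sq x₀ x).const_mul (-1 / r ^ 2))).add (hgl.const_mul (-1))
          have he : B s = fun y => m - ε - A * (s - a') + -1 / r ^ 2 * ‖y - x₀‖ ^ 2 +
              -1 * g s y := by
            ext y
            simp only [hB]
            ring
          rw [he]
          exact h1.congr (by simp) (by ring)
        · intro hxb
          have h1 := inner_outward_sub_nonneg hxb hx₀.1
          have h2 := hgG hxb
          rw [real_inner_comm] at h1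
          simp only [add_apply, smul_apply, innerSL_apply_apply, smul_eq_mul]
          have h3 : 0 ≤ 1 / r ^ 2 * (2 * inner ℝ (x - x₀) (outward K x)) := by positivity
          have h4 : -1 / r ^ 2 * (2 * inner ℝ (x - x₀) (outward K x)) =
            -(1 / r ^ 2 * (2 * inner ℝ (x - x₀) (outward K x))) := by ring
          linarith
        · have h1 := hF (u s x) hux
          have h2 := le_abs_self F
          linarith
  have h1 := (hcomp t ⟨ha'.2.le, le_rfl⟩ z hz).le
  have h2 := hgt z hz
  have h3 : A * (t - a') ≤ A * (t - a) := by gcongr; exact ha'.1.le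
  rw [dist_eq_norm]
  simp only [hB] at h1
  linarith

/-! ### Shields away from the lateral boundary -/

theorem exists_equal_ball_cover {d : ℕ} {Z : Set (Euc d)} (hZ : IsCompact Z) {η : ℝ} (hη : 0 < η)
    (hv : volume Z < ENNReal.ofReal η) :
    ∃ ρ > 0, ∃ C : Finset (Euc d), (∀ z ∈ Z, ∃ c ∈ C, dist z c ≤ ρ) ∧
      C.card * ρ ^ (d + 1) * volume.real (Metric.closedBall (0 : Euc d) 1) ≤ 5 ^ (d + 1) * η := by
  classical
  obtain ⟨U, hZU, hUo, hUη⟩ := Z.exists_isOpen_lt_of_lt _ hv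
  obtain ⟨δ, hδ, hδU⟩ := hZ.exists_cthickening_subset_open hUo hZU
  lift δ to NNReal using hδ.le
  obtain ⟨N, hNZ, hNf, hN'⟩ := Metric.exists_finite_isCover_of_isCompact
    (ε := δ) (by exact_mod_cast hδ.ne') hZ
  have hN := Metric.isCover_iff_subset_iUnion_closedBall.1 hN'
  obtain ⟨S, hSN, hSd, hS⟩ := Vitali.exists_disjoint_subfamily_covering_enlargement_closedBall
    N (fun y : Euc d => y) (fun _ => (δ : ℝ)) δ (fun _ _ => le_rfl) 5 (by norm_num)
  have hSf : S.Finite := hNf.subset hSN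
  refine ⟨5 * δ, by positivity, hSf.toFinset, fun z hz => ?_, ?_⟩
  · obtain ⟨y, hyN, hy⟩ := mem_iUnion₂.1 (hN hz)
    obtain ⟨c, hc, hcb⟩ := hS y hyN
    exact ⟨c, hSf.mem_toFinset.2 hc, hcb hy⟩
  · have hsub : (⋃ c ∈ hSf.toFinset, Metric.closedBall c δ) ⊆ U := by
      refine iUnion₂_subset fun c hc => ?_
      exact (Metric.closedBall_subset_cthickening (hNZ (hSN (hSf.mem_toFinset.1 hc))) δ).trans hδU
    have h1 : volume (⋃ c ∈ hSf.toFinset, Metric.closedBall c δ) =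
        ∑ c ∈ hSf.toFinset, volume (Metric.closedBall c δ) := by
      refine measure_biUnion_finset ?_ fun c _ => Metric.isClosed_closedBall.measurableSet
      rw [hSf.coe_toFinset]
      exact hSd
    have h2 : ∀ c : Euc d, volume (Metric.closedBall c δ) =
        ENNReal.ofReal (δ ^ (d + 1) * volume.real (Metric.closedBall (0 : Euc d) 1)) := by
      intro c
      rw [Measure.addHaar_closedBall' volume c δ.coe_nonneg, ENNReal.ofReal_mul (by positivity),
        ofReal_measureReal (by exact measure_closedBall_lt_top.ne)]
      simp
    simp only [h2, Finset.sum_const, nsmul_eq_mul] at h1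
    have h3 := (measure_mono hsub).trans hUη.le
    rw [h1, ← ENNReal.ofReal_natCast, ← ENNReal.ofReal_mul (by positivity),
      ENNReal.ofReal_le_ofReal_iff hη.le] at h3
    calc _ = 5 ^ (d + 1) * (hSf.toFinset.card *
          (δ ^ (d + 1) * volume.real (Metric.closedBall (0 : Euc d) 1))) := by
          rw [mul_pow]; ring
      _ ≤ _ := by gcongr

theorem ConeSol.hasShield_interior {d : ℕ} {K L : ℝ} {f : ℝ → ℝ} {u : ℝ → Euc d → ℝ}
    (hu : ConeSol d K L f u) {x₀ : Euc d} {r : ℝ}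
    (hball : ∀ x ∈ Metric.closedBall x₀ r, ‖x‖ < K * x 0 ∧ L < ‖x‖) {a b m : ℝ}
    (hinit : ∀ x ∈ Metric.closedBall x₀ r ∩ coneEnd d K L, m ≤ u a x) {t : ℝ}
    (ht : t ∈ Ioc a b) {ε : ℝ} (hε : 0 < ε) :
    HasShield K u (Metric.closedBall x₀ r ∩ coneEnd d K L) a t m ε := by
  have hsubX : Metric.closedBall x₀ r ⊆ coneEnd d K L := fun x hx =>
    ⟨(hball x hx).1.le, (hball x hx).2⟩
  rw [inter_eq_left.2 hsubX] at hinit ⊢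
  set Q := Metric.closedBall x₀ r with hQ
  have hQc : IsCompact Q := isCompact_closedBall x₀ r
  have hat : 0 < t - a := sub_pos.2 ht.1
  set V := volume.real (Metric.closedBall (0 : Euc d) 1) with hV
  have hV0 : 0 < V := by
    rw [hV, measureReal_def, ENNReal.toReal_pos_iff]
    exact ⟨Metric.measure_closedBall_pos _ _ one_pos, measure_closedBall_lt_top⟩
  set κ : ℝ := ((d : ℝ) + 1) / 2 with hκ
  have hκ0 : 0 < κ := by positivity
  set σ := (t - a) / 2 with hσ
  have hσ0 : 0 < σ := by positivity
  have hσκ : 0 < σ ^ κ := Real.rpow_pos_of_pos hσ0 κ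
  set η := ε * V * σ ^ κ / (5 ^ (d + 1) * Real.exp (1 / 4)) with hη
  have hη0 : 0 < η := by positivity
  set as : ℕ → ℝ := fun k => a + (t - a) / (k + 3) with has
  have hasm : ∀ k, as k ∈ Ioo a (a + σ) := by
    intro k
    have h3 : (2 : ℝ) < k + 3 := by
      have : (0 : ℝ) ≤ k := Nat.cast_nonneg k
      linarith
    exact ⟨lt_add_of_pos_right _ (by positivity),
      add_lt_add_right (div_lt_div_of_pos_left hat (by norm_num) h3) a⟩
  have hlim : Tendsto as atTop (𝓝 a) := by
    have h1 : Tendsto (fun k : ℕ => (k : ℝ) + 3) atTop atTop :=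
      tendsto_atTop_add_const_right _ _ tendsto_natCast_atTop_atTop
    simpa [has] using (tendsto_const_nhds (x := a)).add (h1.const_div_atTop (t - a))
  have : IsFiniteMeasure (volume.restrict Q) :=
    ⟨by rw [Measure.restrict_apply_univ]; exact hQc.measure_lt_top⟩
  have hmeas := tendstoInMeasure_of_tendsto_ae (μ := volume.restrict Q)
    (f := fun k => u (as k)) (g := u a)
    (fun k => (((hu.space_reg (as k)).continuousOn.mono hsubX)).aestronglyMeasurable
      hQc.measurableSet)
    (by
      filter_upwards [ae_restrict_mem hQc.measurableSet] with x hx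
      exact ((hu.time_diff x (hsubX hx)).continuous.tendsto a).comp hlim)
  have h0 := hmeas (ENNReal.ofReal ε) (by simpa using hε)
  obtain ⟨k, hk⟩ := (h0.eventually (gt_mem_nhds (show (0 : ENNReal) < ENNReal.ofReal η by
    simpa using hη0))).exists
  set Z : Set (Euc d) := {x ∈ Q | u (as k) x ≤ m - ε} with hZ
  have hZc : IsCompact Z :=
    hQc.of_isClosed_subset (((hu.space_reg (as k)).continuousOn.mono hsubX).preimage_isClosed_of_isClosed
      hQc.isClosed isClosed_Iic) (inter_subset_left)
  have hZv : volume Z < ENNReal.ofReal η := by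
    refine lt_of_le_of_lt ?_ hk
    rw [Measure.restrict_apply' hQc.measurableSet]
    refine measure_mono fun x hx => ⟨?_, hx.1⟩
    have h1 := hinit x hx.1
    have h2 : u (as k) x ≤ m - ε := hx.2
    show ENNReal.ofReal ε ≤ edist (u (as k) x) (u a x)
    rw [edist_dist, dist_comm, Real.dist_eq]
    refine ENNReal.ofReal_le_ofReal ?_
    linarith [le_abs_self (u a x - u (as k) x)]
  obtain ⟨ρ, hρ, C, hcov, hcard⟩ := exists_equal_ball_cover hZc hη0 hZv
  refine ⟨as k, ⟨(hasm k).1, by linarith [(hasm k).2]⟩,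
    fun s x => ∑ c ∈ C, heatBump κ ρ (as k) (fun y => ‖y - c‖ ^ 2) s x, ?_, ?_, ?_, ?_⟩
  · refine continuousOn_finsetSum _ fun c _ => ?_
    exact (continuousOn_heatBump κ hρ (by fun_prop)).mono
      (prod_mono (fun s hs => hs.1) (subset_univ _))
  · intro s hs x hx
    refine ⟨Finset.sum_nonneg fun c _ => heatBump_nonneg κ hs.1 _ x, ?_⟩
    have h1 : ∀ c : Euc d, ∃ gt l' b : ℝ,
        HasDerivAt (fun s => heatBump κ ρ (as k) (fun y => ‖y - c‖ ^ 2) s x) gt s ∧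
        LapData (heatBump κ ρ (as k) (fun y => ‖y - c‖ ^ 2) s) x
          (b • ((2 : ℝ) • innerSL ℝ (x - c))) l' ∧ l' ≤ gt := by
      intro c
      refine heatBump_supersolution hρ hs.1 (LapData.of_norm_sub_sq c x) ?_ ?_
      · simp only [smul_apply, smul_eq_mul, mul_pow, ← Finset.mul_sum, sum_innerSL_single_sq]
        norm_num
      · rw [hκ]
        linarith
    choose gt l' b hd hl hle using h1
    exact ⟨∑ c ∈ C, gt c, ∑ c ∈ C, l' c, _, HasDerivAt.fun_sum fun c _ => hd c,
      LapData.sum fun c _ => hl c, fun h => absurd h (hball x hx).1.ne,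
      Finset.sum_le_sum fun c _ => hle c⟩
  · intro x hx hxm
    obtain ⟨c, hc, hxc⟩ := hcov x ⟨hx, hxm⟩
    refine (one_le_heatBump (a := as k) κ hρ (Φ := fun y => ‖y - c‖ ^ 2) (x := x) ?_).trans
      (Finset.single_le_sum (f := fun c => heatBump κ ρ (as k) (fun y => ‖y - c‖ ^ 2) (as k) x)
        (fun c _ => heatBump_nonneg κ le_rfl _ x) hc)
    rw [dist_eq_norm] at hxc
    gcongr
  · intro x hx
    have hpow : (ρ ^ 2 / σ) ^ κ = ρ ^ (d + 1) / σ ^ κ := by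
      rw [Real.div_rpow (by positivity) hσ0.le, ← Real.rpow_natCast ρ 2, ← Real.rpow_mul hρ.le,
        ← Real.rpow_natCast ρ (d + 1)]
      congr 2
      rw [hκ]
      push_cast
      ring
    calc ∑ c ∈ C, heatBump κ ρ (as k) (fun y => ‖y - c‖ ^ 2) t x
        ≤ ∑ _c ∈ C, Real.exp (1 / 4) * (ρ ^ 2 / σ) ^ κ := Finset.sum_le_sum fun c _ =>
          heatBump_le hκ0.le hσ0 (by linarith [(hasm k).2]) (by positivity)
      _ = C.card * ρ ^ (d + 1) * V * (Real.exp (1 / 4) / (V * σ ^ κ)) := by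
          rw [Finset.sum_const, nsmul_eq_mul, hpow]
          field_simp
      _ ≤ 5 ^ (d + 1) * η * (Real.exp (1 / 4) / (V * σ ^ κ)) := by gcongr
      _ = ε := by
          rw [hη]
          field_simp

/-! ### Shields at the lateral boundary -/

theorem ConeSol.continuousOn {d : ℕ} {K L : ℝ} {f : ℝ → ℝ} {u : ℝ → Euc d → ℝ}
    (hu : ConeSol d K L f u) (t : ℝ) : ContinuousOn (u t) (coneEnd d K L) :=
  (hu.space_reg t).continuousOn

theorem ConeSol.eventually_lipschitz {d : ℕ} {K L : ℝ} {f : ℝ → ℝ} {u : ℝ → Euc d → ℝ}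
    (hu : ConeSol d K L f u) (t : ℝ) {x : Euc d} (hx : x ∈ coneEnd d K L) :
    ∃ C : ℝ, ∀ᶠ y in 𝓝[coneEnd d K L] x, |u t y - u t x| ≤ C * dist y x := by
  have h := ((hu.space_reg t).differentiableOn (by norm_num) x hx).isBigO_sub
  obtain ⟨C, hC⟩ := h.bound
  refine ⟨C, hC.mono fun y hy => ?_⟩
  rwa [Real.norm_eq_abs, ← dist_eq_norm] at hy

theorem continuous_coneDefect {d : ℕ} (K : ℝ) : Continuous (coneDefect (d := d) K) := by
  unfold coneDefect
  fun_prop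

theorem continuous_outward {d : ℕ} (K : ℝ) : Continuous (outward (d := d) K) := by
  unfold outward
  fun_prop

theorem ConeSol.rightLSCAt_interior {d : ℕ} {K L : ℝ} {f : ℝ → ℝ} {u : ℝ → Euc d → ℝ}
    (hu : ConeSol d K L f u) (hf : Continuous f) (t : ℝ) {x : Euc d} (hx : ‖x‖ < K * x 0)
    (hxL : L < ‖x‖) : RightLSCAt (coneEnd d K L) u t x := by
  set Y : Set (Euc d) := {x | ‖x‖ < K * x 0 ∧ L < ‖x‖} with hY
  have hYo : IsOpen Y :=
    (isOpen_lt continuous_norm (continuous_const.mul (continuous_coord 0))).inter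
      (isOpen_lt continuous_const continuous_norm)
  have hYX : Y ⊆ coneEnd d K L := fun y hy => ⟨hy.1.le, hy.2⟩
  have hball : ∀ y ∈ Y, ∃ R > 0, Metric.closedBall y R ⊆ Y := fun y hy =>
    Metric.nhds_basis_closedBall.mem_iff.1 (hYo.mem_nhds hy)
  refine rightLSCAt_of_forwardBound hYX ?_ (fun y hy => hu.time_diff y (hYX hy)) hu.continuousOn
    (fun s y hy => hu.eventually_lipschitz s (hYX hy)) ?_ t x ⟨hx, hxL⟩
  · intro y hy
    obtain ⟨R, hR, hRY⟩ := hball y hy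
    refine ⟨R, hR, isCompact_closedBall_inter_coneEnd fun z hz => (hRY hz).2, ?_⟩
    exact inter_subset_left.trans hRY
  · intro y hy
    obtain ⟨R, hR, hRY⟩ := hball y hy
    refine hu.forwardBound_of_shield hf (hYX hy) hR (fun z hz => (hRY hz).2) ?_
    intro r _ hrR a b m _ hinit s hs ε hε
    exact hu.hasShield_interior
      (fun z hz => hRY (Metric.closedBall_subset_closedBall hrR.le hz)) hinit hs hε

theorem ConeSol.hasShield_boundary {d : ℕ} {K L : ℝ} {f : ℝ → ℝ} {u : ℝ → Euc d → ℝ}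
    (hu : ConeSol d K L f u) (hf : Continuous f) {x₀ : Euc d} {r κ : ℝ} (hκ : 0 < κ)
    (hball : ∀ x ∈ Metric.closedBall x₀ r, L < ‖x‖)
    (hgrad : ∀ x ∈ Metric.closedBall x₀ r, 4 * κ * ‖outward K x‖ ^ 2 ≤ 1)
    (hlap : ∀ x ∈ Metric.closedBall x₀ r,
      1 / 2 ≤ 8 * κ * ‖outward K x‖ ^ 2 + 2 * κ * coneDefect K x * (2 * K ^ 2 - 2 * (d + 1)))
    {a b m : ℝ}
    (hinit : ∀ x ∈ Metric.closedBall x₀ r ∩ coneEnd d K L, m ≤ u a x) {t : ℝ}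
    (ht : t ∈ Ioc a b) {ε : ℝ} (hε : 0 < ε) :
    HasShield K u (Metric.closedBall x₀ r ∩ coneEnd d K L) a t m ε := by
  set Q := Metric.closedBall x₀ r ∩ coneEnd d K L with hQ
  have hQc : IsCompact Q := isCompact_closedBall_inter_coneEnd hball
  have hat : 0 < t - a := sub_pos.2 ht.1
  set σ := (t - a) / 2 with hσ
  have hσ0 : 0 < σ := by positivity
  set Φ : Euc d → ℝ := fun x => κ * coneDefect K x ^ 2 with hΦ
  have hΦc : Continuous Φ := continuous_const.mul ((continuous_coneDefect K).pow 2)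
  obtain ⟨ρ, hρ, hρε⟩ : ∃ ρ > 0, Real.exp (1 / 4) * (ρ ^ 2 / σ) ^ (1 / 8 : ℝ) ≤ ε := by
    have hc : ContinuousAt (fun ρ : ℝ => Real.exp (1 / 4) * (ρ ^ 2 / σ) ^ (1 / 8 : ℝ)) 0 := by
      refine ContinuousAt.mul continuousAt_const (ContinuousAt.rpow_const ?_ (by norm_num))
      fun_prop
    have h0 : Real.exp (1 / 4) * ((0 : ℝ) ^ 2 / σ) ^ (1 / 8 : ℝ) < ε := by
      rw [zero_pow (by norm_num), zero_div, Real.zero_rpow (by norm_num), mul_zero]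
      exact hε
    have h1 : ∀ᶠ ρ : ℝ in 𝓝[>] 0, Real.exp (1 / 4) * (ρ ^ 2 / σ) ^ (1 / 8 : ℝ) < ε :=
      nhdsWithin_le_nhds (hc.eventually (gt_mem_nhds h0))
    obtain ⟨ρ, h2, h3⟩ := (h1.and self_mem_nhdsWithin).exists
    exact ⟨ρ, h3, h2.le⟩
  set Z : Set (Euc d) := Q ∩ {x | ρ ^ 2 ≤ Φ x} with hZ
  have hZc : IsCompact Z := hQc.inter_right (isClosed_le continuous_const hΦc)
  have hev : ∀ᶠ s in 𝓝 a, ∀ x ∈ Z, a ≤ s → x ∈ Q → m - ε < u s x := by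
    refine hZc.eventually_forall_of_forall_eventually fun x hx => ?_
    have hlt : ‖x‖ < K * x 0 := by
      refine hx.1.2.1.lt_of_ne fun heq => ?_
      have h1 : ρ ^ 2 ≤ κ * coneDefect K x ^ 2 := hx.2
      have h2 : coneDefect K x = 0 := by
        rw [coneDefect, heq]
        ring
      rw [h2] at h1
      have : 0 < ρ ^ 2 := by positivity
      linarith
    obtain ⟨η, hη, h⟩ := hu.rightLSCAt_interior hf a hlt hx.1.2.2 ε hε
    have h3 : ∀ᶠ p : ℝ × Euc d in 𝓝 (a, x), p ∈ Iio (a + η) ×ˢ Metric.ball x η :=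
      prod_mem_nhds (Iio_mem_nhds (by linarith)) (Metric.ball_mem_nhds x hη)
    filter_upwards [h3] with p hp hap hpQ
    have := h p.1 hap hp.1 p.2 hpQ.2 hp.2
    linarith [hinit x hx.1]
  have hev' : ∀ᶠ s in 𝓝[>] a, ∀ x ∈ Z, a ≤ s → x ∈ Q → m - ε < u s x := nhdsWithin_le_nhds hev
  obtain ⟨a', h1, h2⟩ := (hev'.and (Ioo_mem_nhdsGT (lt_add_of_pos_right a hσ0))).exists
  refine ⟨a', ⟨h2.1, by linarith [h2.2]⟩, heatBump (1 / 8) ρ a' Φ, ?_, ?_, ?_, ?_⟩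
  · exact (continuousOn_heatBump _ hρ hΦc).mono (prod_mono (fun s hs => hs.1) (subset_univ _))
  · intro s hs x hx
    refine ⟨heatBump_nonneg _ hs.1 _ x, ?_⟩
    have hl : LapData Φ x ((2 * κ * coneDefect K x) • ((-2 : ℝ) • innerSL ℝ (outward K x)))
        (8 * κ * ‖outward K x‖ ^ 2 + 2 * κ * coneDefect K x * (2 * K ^ 2 - 2 * (d + 1))) := by
      have h := (lapData_coneDefect K x).comp_of_hasDerivAt (Ψ := fun z => κ * z ^ 2)
        (Ψ' := fun z => 2 * κ * z) (p := 2 * κ) (by fun_prop)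
        (Eventually.of_forall fun z => by
          refine (((hasDerivAt_id' z).fun_pow 2).const_mul κ).congr_deriv ?_
          simp
          ring)
        (by simpa using (hasDerivAt_id' (coneDefect K x)).const_mul (2 * κ))
      convert h using 1
      simp only [smul_apply, smul_eq_mul, mul_pow, ← Finset.mul_sum, sum_innerSL_single_sq]
      ring
    obtain ⟨gt, l', b', hd, hl', hle⟩ := heatBump_supersolution (κ := 1 / 8) hρ hs.1 hl
      (by
        simp only [smul_apply, smul_eq_mul, mul_pow, ← Finset.mul_sum, sum_innerSL_single_sq]
        have h := mul_le_mul_of_nonneg_left (hgrad x hx.1)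
          (by positivity : 0 ≤ 4 * κ * coneDefect K x ^ 2)
        simp only [hΦ]
        linarith)
      (by linarith [hlap x hx.1])
    refine ⟨gt, l', _, hd, hl', fun heq => ?_, hle⟩
    have h3 : coneDefect K x = 0 := by
      rw [coneDefect, heq]
      ring
    simp [h3]
  · intro x hx hxm
    refine one_le_heatBump _ hρ ?_
    by_contra! hgt
    exact absurd (h1 x ⟨hx, hgt.le⟩ h2.1.le hx) (not_lt.2 hxm)
  · intro x _
    refine le_trans (heatBump_le (by norm_num) hσ0 (by linarith [h2.2]) ?_) hρε
    positivity

theorem ConeSol.rightLSCAt {d : ℕ} {K L : ℝ} {f : ℝ → ℝ} {u : ℝ → Euc d → ℝ}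
    (hu : ConeSol d K L f u) (hf : Continuous f) (t : ℝ) {x : Euc d} (hx : x ∈ coneEnd d K L) :
    RightLSCAt (coneEnd d K L) u t x := by
  have hLo : IsOpen {x : Euc d | L < ‖x‖} := isOpen_lt continuous_const continuous_norm
  refine rightLSCAt_of_forwardBound subset_rfl ?_ hu.time_diff hu.continuousOn
    (fun s y hy => hu.eventually_lipschitz s hy) ?_ t x hx
  · intro y hy
    obtain ⟨R, hR, hRL⟩ := Metric.nhds_basis_closedBall.mem_iff.1 (hLo.mem_nhds hy.2)
    exact ⟨R, hR, isCompact_closedBall_inter_coneEnd hRL, inter_subset_right⟩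
  · intro y hy
    rcases hy.1.lt_or_eq with hlt | heq
    · have hYo : IsOpen {x : Euc d | ‖x‖ < K * x 0 ∧ L < ‖x‖} :=
        (isOpen_lt continuous_norm (continuous_const.mul (continuous_coord 0))).inter hLo
      obtain ⟨R, hR, hRY⟩ := Metric.nhds_basis_closedBall.mem_iff.1
        (hYo.mem_nhds (show y ∈ _ from ⟨hlt, hy.2⟩))
      refine hu.forwardBound_of_shield hf hy hR (fun z hz => (hRY hz).2) ?_
      intro r _ hrR a b m _ hinit s hs ε hε
      exact hu.hasShield_interior
        (fun z hz => hRY (Metric.closedBall_subset_closedBall hrR.le hz)) hinit hs hε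
    · have hW : 0 < ‖outward K y‖ ^ 2 := by
        have := outward_ne_zero hu.one_lt hu.L_pos hy
        positivity
      set κ : ℝ := 1 / (8 * ‖outward K y‖ ^ 2) with hκ
      have hκ0 : 0 < κ := by positivity
      have hκW : κ * ‖outward K y‖ ^ 2 = 1 / 8 := by
        rw [hκ, one_div_mul_eq_div, div_eq_div_iff (by positivity) (by norm_num)]
        ring
      have hD : coneDefect K y = 0 := by
        rw [coneDefect, heq]
        ring
      have hc := (continuous_outward (d := d) K).norm.pow 2
      have h1 : ∀ᶠ z in 𝓝 y, 4 * κ * ‖outward K z‖ ^ 2 < 1 :=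
        (continuous_const.mul hc).continuousAt.eventually
          (gt_mem_nhds (by show 4 * κ * ‖outward K y‖ ^ 2 < 1; linarith))
      have h2 : ∀ᶠ z in 𝓝 y, 1 / 2 < 8 * κ * ‖outward K z‖ ^ 2 +
          2 * κ * coneDefect K z * (2 * K ^ 2 - 2 * (d + 1)) :=
        ((continuous_const.mul hc).add
          ((continuous_const.mul (continuous_coneDefect K)).mul
            continuous_const)).continuousAt.eventually
          (lt_mem_nhds (by
            show 1 / 2 < 8 * κ * ‖outward K y‖ ^ 2 +
              2 * κ * coneDefect K y * (2 * K ^ 2 - 2 * (d + 1))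
            rw [hD]
            linarith))
      obtain ⟨R, hR, hRY⟩ := Metric.nhds_basis_closedBall.mem_iff.1
        (inter_mem (hLo.mem_nhds hy.2) (inter_mem h1 h2))
      refine hu.forwardBound_of_shield hf hy hR (fun z hz => (hRY hz).1) ?_
      intro r _ hrR a b m _ hinit s hs ε hε
      have hsub := (Metric.closedBall_subset_closedBall (x := y) hrR.le).trans hRY
      exact hu.hasShield_boundary hf hκ0 (fun z hz => (hsub hz).1)
        (fun z hz => (hsub hz).2.1.le) (fun z hz => (hsub hz).2.2.le) hinit hs hε

/-! ### The planar front -/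

theorem PlanarFront.hasDerivAt {f φ : ℝ → ℝ} {θ c : ℝ} (hφ : PlanarFront f θ c φ) (z : ℝ) :
    HasDerivAt φ (deriv φ z) z :=
  (hφ.smooth.differentiable (by norm_num) z).hasDerivAt

theorem PlanarFront.contDiff_deriv {f φ : ℝ → ℝ} {θ c : ℝ} (hφ : PlanarFront f θ c φ) :
    ContDiff ℝ 1 (deriv φ) :=
  (contDiff_succ_iff_deriv (n := 1).1 (by rw [one_add_one_eq_two]; exact hφ.smooth)).2.2

theorem PlanarFront.hasDerivAt_deriv {f φ : ℝ → ℝ} {θ c : ℝ} (hφ : PlanarFront f θ c φ) (z : ℝ) :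
    HasDerivAt (deriv φ) (-c * deriv φ z - f (φ z)) z := by
  have h := (hφ.contDiff_deriv.differentiable (by norm_num) z).hasDerivAt
  rwa [show deriv (deriv φ) z = -c * deriv φ z - f (φ z) by linarith [hφ.ode z]] at h

theorem PlanarFront.deriv_neg {f φ : ℝ → ℝ} {θ c : ℝ} (hf : Bistable f θ)
    (hφ : PlanarFront f θ c φ) (z : ℝ) : deriv φ z < 0 := by
  have hle : ∀ z, deriv φ z ≤ 0 := fun z => hφ.anti.antitone.deriv_nonpos
  have hw : ∀ z, HasDerivAt (fun z => deriv φ z * Real.exp (c * z))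
      (-f (φ z) * Real.exp (c * z)) z := by
    intro z
    refine ((hφ.hasDerivAt_deriv z).mul ((hasDerivAt_id' z).const_mul c).exp).congr_deriv ?_
    ring
  refine (hle z).lt_of_ne fun h0 => ?_
  have hmax : IsLocalMax (deriv φ) z := Eventually.of_forall fun y => by
    rw [h0]
    exact hle y
  have h1 := hmax.hasDerivAt_eq_zero (hφ.hasDerivAt_deriv z)
  rw [h0] at h1
  have hfz : f (φ z) = 0 := by linarith
  have hz : φ z = θ := by
    rcases lt_trichotomy (φ z) θ with h | h | h
    · exact absurd hfz (hf.neg _ ⟨(hφ.mem z).1, h⟩).ne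
    · exact h
    · exact absurd hfz (hf.pos _ ⟨h, (hφ.mem z).2⟩).ne'
  have hz0 : z = 0 := hφ.anti.injective (hz.trans hφ.pin.symm)
  subst hz0
  have hanti : StrictAntiOn (fun z => deriv φ z * Real.exp (c * z)) (Iic 0) := by
    refine strictAntiOn_of_deriv_neg (convex_Iic 0)
      (fun z _ => (hw z).continuousAt.continuousWithinAt) fun z hz => ?_
    rw [interior_Iic] at hz
    rw [(hw z).deriv]
    have h2 : θ < φ z := by
      rw [← hφ.pin]
      exact hφ.anti hz
    have := hf.pos _ ⟨h2, (hφ.mem z).2⟩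
    have := mul_pos this (Real.exp_pos (c * z))
    linarith
  have h3 := hanti (by norm_num : (-1 : ℝ) ∈ Iic 0) (by norm_num : (0 : ℝ) ∈ Iic 0) (by norm_num)
  simp only [h0, zero_mul] at h3
  have := mul_nonpos_of_nonpos_of_nonneg (hle (-1)) (Real.exp_pos (c * -1)).le
  linarith

theorem Bistable.exists_stable_slopes {f : ℝ → ℝ} {θ : ℝ} (hf : Bistable f θ) :
    ∃ κ > 0, ∃ η ∈ Ioo (0 : ℝ) 1, ∃ M ≥ 0,
      (∀ x y, 0 ≤ x → x ≤ y → y ≤ η → f y - f x ≤ -κ * (y - x)) ∧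
      (∀ x y, 1 - η ≤ x → x ≤ y → y ≤ 1 → f y - f x ≤ -κ * (y - x)) ∧
      ∀ x y, 0 ≤ x → x ≤ y → y ≤ 1 → f y - f x ≤ M * (y - x) := by
  have hd : Differentiable ℝ f := hf.smooth.differentiable (by norm_num)
  have hc : Continuous (deriv f) := hf.smooth.continuous_deriv (by norm_num)
  set κ := min (-deriv f 0) (-deriv f 1) / 2 with hκ
  have hm : 0 < min (-deriv f 0) (-deriv f 1) :=
    lt_min (by linarith [hf.df0]) (by linarith [hf.df1])
  have hκ0 : 0 < κ := by positivity
  have h0 : deriv f 0 < -κ := by linarith [min_le_left (-deriv f 0) (-deriv f 1)]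
  have h1 : deriv f 1 < -κ := by linarith [min_le_right (-deriv f 0) (-deriv f 1)]
  obtain ⟨η₀, hη₀, hb₀⟩ := Metric.eventually_nhds_iff.1 (hc.continuousAt.eventually (gt_mem_nhds h0))
  obtain ⟨η₁, hη₁, hb₁⟩ := Metric.eventually_nhds_iff.1 (hc.continuousAt.eventually (gt_mem_nhds h1))
  obtain ⟨M, hM⟩ := isCompact_Icc.exists_bound_of_continuousOn (hc.continuousOn (s := Icc 0 1))
  have key : ∀ C x y : ℝ, x ≤ y → (∀ z ∈ Icc x y, deriv f z ≤ C) → f y - f x ≤ C * (y - x) := by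
    intro C x y hxy hC
    exact (convex_Icc x y).image_sub_le_mul_sub_of_deriv_le hd.continuous.continuousOn
      hd.differentiableOn (fun z hz => hC z (interior_subset hz)) x (left_mem_Icc.2 hxy)
      y (right_mem_Icc.2 hxy) hxy
  have hmn : 0 < min (min η₀ η₁) 1 := lt_min (lt_min hη₀ hη₁) one_pos
  refine ⟨κ, hκ0, min (min η₀ η₁) 1 / 2, ⟨by positivity, ?_⟩, M,
    (norm_nonneg _).trans (hM 0 (by norm_num)), ?_, ?_, ?_⟩
  · linarith [min_le_right (min η₀ η₁) 1]
  · intro x y hx hxy hy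
    refine key _ x y hxy fun z hz => (hb₀ ?_).le
    rw [Real.dist_eq, sub_zero, abs_of_nonneg (hx.trans hz.1)]
    linarith [hz.2, min_le_left (min η₀ η₁) 1, min_le_left η₀ η₁]
  · intro x y hx hxy hy
    refine key _ x y hxy fun z hz => (hb₁ ?_).le
    rw [Real.dist_eq, abs_sub_comm, abs_of_nonneg (by linarith [hz.2])]
    linarith [hz.1, min_le_left (min η₀ η₁) 1, min_le_right η₀ η₁]
  · intro x y hx hxy hy
    exact key _ x y hxy fun z hz =>
      (abs_le.1 (hM z ⟨hx.trans hz.1, hz.2.trans hy⟩)).2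

theorem PlanarFront.exists_decay {f φ : ℝ → ℝ} {θ c κ η : ℝ} (hf : Bistable f θ)
    (hφ : PlanarFront f θ c φ) (hκ : 0 < κ) (hη : η ∈ Ioo (0 : ℝ) 1)
    (hslope : ∀ x y, 1 - η ≤ x → x ≤ y → y ≤ 1 → f y - f x ≤ -κ * (y - x)) :
    ∃ l > 0, ∃ C ≥ 0, ∃ A : ℝ, ∀ z ≤ A, 1 - η / 2 ≤ φ z ∧ -deriv φ z ≤ C * Real.exp (l * z) := by
  obtain ⟨A, hA⟩ := eventually_atBot.1 (hφ.lim_bot.eventually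
    (lt_mem_nhds (by linarith [hη.1] : 1 - η / 2 < 1)))
  set l := (-c + √(c ^ 2 + 4 * κ)) / 2 with hl
  have hc := hφ.cpos
  have hsq : √(c ^ 2 + 4 * κ) ^ 2 = c ^ 2 + 4 * κ := Real.sq_sqrt (by positivity)
  have hl2 : l * (l + c) = κ := by
    rw [hl]
    linarith
  have hl0 : 0 < l := by
    have : c < √(c ^ 2 + 4 * κ) := Real.lt_sqrt_of_sq_lt (by linarith)
    rw [hl]
    linarith
  set g : ℝ → ℝ := fun z => -deriv φ z + (l + c) * (1 - φ z) with hg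
  have hgd : ∀ z, HasDerivAt (fun z => g z * Real.exp (-l * z))
      ((c * deriv φ z + f (φ z) - (l + c) * deriv φ z - l * g z) * Real.exp (-l * z)) z := by
    intro z
    have h1 := (hφ.hasDerivAt_deriv z).neg.add (((hφ.hasDerivAt z).const_sub 1).const_mul (l + c))
    refine (h1.mul ((hasDerivAt_id' z).const_mul (-l)).exp).congr_deriv ?_
    simp only [hg, Pi.add_apply, Pi.neg_apply]
    ring
  have hmono : MonotoneOn (fun z => g z * Real.exp (-l * z)) (Iic A) := by
    refine monotoneOn_of_deriv_nonneg (convex_Iic A)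
      (fun z _ => (hgd z).continuousAt.continuousWithinAt)
      (fun z _ => (hgd z).differentiableAt.differentiableWithinAt) fun z hz => ?_
    rw [interior_Iic] at hz
    rw [(hgd z).deriv]
    refine mul_nonneg ?_ (Real.exp_pos _).le
    have h2 := hslope (φ z) 1 (by linarith [hA z hz.le, hη.1]) (hφ.mem z).2.le le_rfl
    rw [hf.f1] at h2
    simp only [hg]
    nlinarith [congrArg (· * (1 - φ z)) hl2]
  have hg0 : ∀ z, 0 ≤ g z := fun z => by
    have h1 := (hφ.deriv_neg hf z).le
    have h2 : 0 ≤ (l + c) * (1 - φ z) := mul_nonneg (by positivity) (by linarith [(hφ.mem z).2])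
    simp only [hg]
    linarith
  refine ⟨l, hl0, g A * Real.exp (-l * A), mul_nonneg (hg0 A) (Real.exp_pos _).le, A,
    fun z hz => ⟨(hA z hz).le, ?_⟩⟩
  have h3 : g z * Real.exp (-l * z) ≤ g A * Real.exp (-l * A) := hmono hz self_mem_Iic hz
  have h4 : -deriv φ z ≤ g z := by
    have h2 : 0 ≤ (l + c) * (1 - φ z) := mul_nonneg (by positivity) (by linarith [(hφ.mem z).2])
    simp only [hg]
    linarith
  calc -deriv φ z ≤ g z := h4
    _ = g z * Real.exp (-l * z) * Real.exp (l * z) := by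
      rw [mul_assoc, ← Real.exp_add]
      simp
    _ ≤ _ := by gcongr

theorem PlanarFront.exists_slope {f φ : ℝ → ℝ} {θ c : ℝ} (hf : Bistable f θ)
    (hφ : PlanarFront f θ c φ) {a b : ℝ} (ha : 0 < a) (hb : b < 1) :
    ∃ m > 0, ∀ z, a ≤ φ z → φ z ≤ b → deriv φ z ≤ -m := by
  obtain ⟨A, hA⟩ := eventually_atBot.1 (hφ.lim_bot.eventually (lt_mem_nhds hb))
  obtain ⟨B, hB⟩ := eventually_atTop.1 (hφ.lim_top.eventually (gt_mem_nhds ha))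
  rcases (Icc A B).eq_empty_or_nonempty with he | hne
  · refine ⟨1, one_pos, fun z hz1 hz2 => absurd (?_ : z ∈ Icc A B) (he ▸ notMem_empty z)⟩
    exact ⟨not_lt.1 fun h => absurd (hA z h.le) (not_lt.2 hz2),
      not_lt.1 fun h => absurd (hB z h.le) (not_lt.2 hz1)⟩
  · obtain ⟨z₀, -, hz₀⟩ := isCompact_Icc.exists_isMaxOn hne
      (hφ.contDiff_deriv.continuous.continuousOn)
    refine ⟨-deriv φ z₀, neg_pos.2 (hφ.deriv_neg hf z₀), fun z hz1 hz2 => ?_⟩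
    rw [neg_neg]
    exact hz₀ ⟨not_lt.1 fun h => absurd (hA z h.le) (not_lt.2 hz2),
      not_lt.1 fun h => absurd (hB z h.le) (not_lt.2 hz1)⟩

/-! ### The radial subsolution -/

/-- The constants of the front entering the construction of the subsolution. -/
structure FrontConstants (f φ : ℝ → ℝ) (κ η M l C A m : ℝ) : Prop where
  κ_pos : 0 < κ
  η_mem : η ∈ Ioo (0 : ℝ) 1
  M_nonneg : 0 ≤ M
  l_pos : 0 < l
  C_nonneg : 0 ≤ C
  m_pos : 0 < m
  slope_zero : ∀ x y, 0 ≤ x → x ≤ y → y ≤ η → f y - f x ≤ -κ * (y - x)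
  slope_one : ∀ x y, 1 - η ≤ x → x ≤ y → y ≤ 1 → f y - f x ≤ -κ * (y - x)
  slope_mid : ∀ x y, 0 ≤ x → x ≤ y → y ≤ 1 → f y - f x ≤ M * (y - x)
  left : ∀ z ≤ A, 1 - η / 2 ≤ φ z ∧ -deriv φ z ≤ C * Real.exp (l * z)
  mid : ∀ z, η ≤ φ z → φ z ≤ 1 - η / 2 → deriv φ z ≤ -m

theorem PlanarFront.exists_frontConstants {f φ : ℝ → ℝ} {θ c : ℝ} (hf : Bistable f θ)
    (hφ : PlanarFront f θ c φ) : ∃ κ η M l C A m : ℝ, FrontConstants f φ κ η M l C A m := by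
  obtain ⟨κ, hκ, η, hη, M, hM, h0, h1, hmid⟩ := hf.exists_stable_slopes
  obtain ⟨l, hl, C, hC, A, hA⟩ := hφ.exists_decay hf hκ hη h1
  obtain ⟨m, hm, hm'⟩ := hφ.exists_slope hf hη.1 (by linarith [hη.1] : 1 - η / 2 < 1)
  exact ⟨κ, η, M, l, C, A, m, hκ, hη, hM, hl, hC, hm, h0, h1, hmid, hA, hm'⟩

/-- Conditions on the square root `y` of the shifted time under which the radial function is a
subsolution. -/
structure LateTime (c D L κ M l C A m δ μ y : ℝ) : Prop where
  one_le : 1 ≤ y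
  log_le : D / c * Real.log (y ^ 2) ≤ y
  four_le : 4 ≤ c * y
  l_le : l ≤ κ * y
  decay_le : C * (D / L) * Real.exp (-(l / 2) * y) ≤ κ * δ / 4
  left : -y ≤ A
  mid : (M + 1) * (δ * Real.exp (μ * L) * Real.exp (-(μ * c / 2) * y)) +
    (M + κ) * (δ * Real.exp (-(l / 2) * y)) < m * ((8 * D / c ^ 2 + 1) / y ^ 3 / 2)
  theta_le : δ * (2 / 3 * Real.log (y ^ 2) ^ ((3 : ℝ) / 2)) ≤ l / 2 * y

theorem eventually_lateTime {c D L κ M l C A m δ μ : ℝ} (hc : 0 < c) (hD : 0 ≤ D) (hκ : 0 < κ)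
    (hl : 0 < l) (hm : 0 < m) (hδ : 0 < δ) (hμ : 0 < μ) :
    ∀ᶠ y in atTop, LateTime c D L κ M l C A m δ μ y := by
  have hexp : ∀ b : ℝ, 0 < b → Tendsto (fun y : ℝ => Real.exp (-b * y)) atTop (𝓝 0) := by
    intro b hb
    refine Real.tendsto_exp_atBot.comp ?_
    exact tendsto_id.const_mul_atTop_of_neg (by linarith)
  have hpexp : ∀ b : ℝ, 0 < b → Tendsto (fun y : ℝ => y ^ 3 * Real.exp (-b * y)) atTop (𝓝 0) := by
    intro b hb
    refine (tendsto_rpow_mul_exp_neg_mul_atTop_nhds_zero 3 b hb).congr fun y => ?_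
    norm_cast
  have hlog : ∀ᶠ y : ℝ in atTop, D / c * Real.log (y ^ 2) ≤ y := by
    have h := (Real.isLittleO_log_id_atTop.def
      (by positivity : (0 : ℝ) < 1 / (2 * (D / c) + 1)))
    filter_upwards [h, eventually_ge_atTop 1] with y hy hy1
    rw [Real.norm_of_nonneg (Real.log_nonneg hy1), id, Real.norm_of_nonneg (by linarith),
      one_div_mul_eq_div, le_div_iff₀ (by positivity)] at hy
    rw [Real.log_pow]
    have := Real.log_nonneg hy1
    push_cast
    linarith
  have hth : ∀ᶠ y : ℝ in atTop, δ * (2 / 3 * Real.log (y ^ 2) ^ ((3 : ℝ) / 2)) ≤ l / 2 * y := by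
    have h := (tendsto_pow_atTop (α := ℝ) (n := 2) (by norm_num)).eventually
      ((isLittleO_log_rpow_rpow_atTop (3 / 2) (by norm_num : (0 : ℝ) < 1 / 2)).def
        (by positivity : (0 : ℝ) < l / 2 / (δ * (2 / 3))))
    filter_upwards [h, eventually_ge_atTop 1] with y hy hy1
    have h1 : 0 ≤ Real.log (y ^ 2) := Real.log_nonneg (one_le_pow₀ hy1)
    rw [Real.norm_of_nonneg (by positivity), Real.norm_of_nonneg (by positivity),
      ← Real.sqrt_eq_rpow, Real.sqrt_sq (by linarith), div_mul_eq_mul_div,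
      le_div_iff₀ (by positivity)] at hy
    linarith
  have hmid : ∀ᶠ y : ℝ in atTop, (M + 1) * (δ * Real.exp (μ * L) * Real.exp (-(μ * c / 2) * y)) +
    (M + κ) * (δ * Real.exp (-(l / 2) * y)) < m * ((8 * D / c ^ 2 + 1) / y ^ 3 / 2) := by
    have h := ((hpexp (μ * c / 2) (by positivity)).const_mul
      ((M + 1) * (δ * Real.exp (μ * L)))).add ((hpexp (l / 2) (by positivity)).const_mul
      ((M + κ) * δ))
    rw [mul_zero, mul_zero, add_zero] at h
    filter_upwards [h.eventually (gt_mem_nhds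
      (by positivity : 0 < m * ((8 * D / c ^ 2 + 1) / 2))), eventually_ge_atTop 1] with y hy hy1
    have hy3 : 0 < y ^ 3 := by positivity
    have e : m * ((8 * D / c ^ 2 + 1) / y ^ 3 / 2) = m * ((8 * D / c ^ 2 + 1) / 2) / y ^ 3 := by
      field_simp
    rw [e, lt_div_iff₀ hy3]
    linarith
  have hdec := ((hexp (l / 2) (by positivity)).const_mul (C * (D / L))).eventually
    (gt_mem_nhds (by rw [mul_zero]; positivity : C * (D / L) * 0 < κ * δ / 4))
  filter_upwards [eventually_ge_atTop 1, hlog, eventually_ge_atTop (4 / c),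
    eventually_ge_atTop (l / κ), hdec, eventually_ge_atTop (-A), hmid, hth]
    with y h1 h2 h3 h4 h5 h6 h7 h8
  rw [div_le_iff₀' hc] at h3
  rw [div_le_iff₀' hκ] at h4
  exact ⟨h1, h2, h3, h4, h5.le, by linarith, h7, h8⟩

theorem drift_lower_bound {c D y r : ℝ} (hc : 0 < c) (hD : 0 ≤ D) (hy : 0 < y)
    (hr1 : c * y ^ 2 - r ≤ 2 * y) (hr2 : c * y ^ 2 / 2 ≤ r) :
    (8 * D / c ^ 2 + 1) / y ^ 3 / 2 ≤
      D / (c * y ^ 2) + (8 * D / c ^ 2 + 1) / y ^ 3 - D / r := by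
  have hcy : 0 < c * y ^ 2 := by positivity
  have hr0 : 0 < r := by linarith
  have h1 : D / r - D / (c * y ^ 2) = D * (c * y ^ 2 - r) / (r * (c * y ^ 2)) := by
    field_simp
  have h2 : D * (c * y ^ 2 - r) / (r * (c * y ^ 2)) ≤
      D * (2 * y) / (c * y ^ 2 / 2 * (c * y ^ 2)) := by
    gcongr
  have h3 : D * (2 * y) / (c * y ^ 2 / 2 * (c * y ^ 2)) = 8 * D / c ^ 2 / y ^ 3 / 2 := by
    field_simp
    ring
  have h4 : 8 * D / c ^ 2 / y ^ 3 / 2 ≤ (8 * D / c ^ 2 + 1) / y ^ 3 / 2 := by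
    gcongr
    linarith
  linarith

set_option maxHeartbeats 800000 in
theorem radial_residual_neg {f φ : ℝ → ℝ} {θ c D L κ η M l C A m δ μ y r v : ℝ}
    (hf : Bistable f θ) (hφ : PlanarFront f θ c φ) (hD : 0 ≤ D) (hL : 0 < L)
    (hk : FrontConstants f φ κ η M l C A m) (hδ : 0 < δ) (hδη : 4 * δ ≤ η) (hμ : 0 < μ)
    (hμ1 : μ ^ 2 ≤ 1) (hμκ : μ ^ 2 ≤ κ) (hy : LateTime c D L κ M l C A m δ μ y) (hr : L ≤ r)
    {ξ : ℝ} (hξ : ξ = r - c * y ^ 2 + D / c * Real.log (y ^ 2) - 2 * (8 * D / c ^ 2 + 1) / y)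
    (hv : v = φ ξ - δ * Real.exp (-(l / 2) * y) - δ * Real.exp (-μ * (r - L))) (hv0 : 0 ≤ v) :
    deriv φ ξ * (D / (c * y ^ 2) + (8 * D / c ^ 2 + 1) / y ^ 3 - D / r) + f (φ ξ) - f v
      + δ * Real.exp (-(l / 2) * y) * (l / (4 * y))
      + μ ^ 2 * (δ * Real.exp (-μ * (r - L))) - μ * (δ * Real.exp (-μ * (r - L))) * (D / r) < 0 := by
  have hc := hφ.cpos
  have hy1 := hy.one_le
  have hr0 : 0 < r := hL.trans_le hr
  set q := δ * Real.exp (-(l / 2) * y) with hq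
  set p := δ * Real.exp (-μ * (r - L)) with hp
  set N := 8 * D / c ^ 2 + 1 with hN
  have hκ := hk.κ_pos
  have hl := hk.l_pos
  have hm := hk.m_pos
  have hM := hk.M_nonneg
  have hN0 : 0 < N := by positivity
  have hq0 : 0 < q := by positivity
  have hp0 : 0 < p := by positivity
  have hqδ : q ≤ δ := by
    refine mul_le_of_le_one_right hδ.le (Real.exp_le_one_iff.2 ?_)
    nlinarith
  have hpδ : p ≤ δ := by
    refine mul_le_of_le_one_right hδ.le (Real.exp_le_one_iff.2 ?_)
    nlinarith
  have hφ' := (hφ.deriv_neg hf ξ).le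
  have hvφ : v ≤ φ ξ := by linarith
  have hφ1 := (hφ.mem ξ).2.le
  have hlq : q * (l / (4 * y)) ≤ κ / 4 * q := by
    have : l / (4 * y) ≤ κ / 4 := by
      rw [div_le_div_iff₀ (by positivity) (by norm_num)]
      linarith [hy.l_le]
    rw [mul_comm]
    gcongr
  have hpD : 0 ≤ μ * p * (D / r) := by positivity
  have hflat : deriv φ ξ * (D / (c * y ^ 2) + N / y ^ 3 - D / r) ≤ κ / 4 * q →
      f (φ ξ) - f v ≤ -κ * (φ ξ - v) →
      deriv φ ξ * (D / (c * y ^ 2) + N / y ^ 3 - D / r) + f (φ ξ) - f v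
        + q * (l / (4 * y)) + μ ^ 2 * p - μ * p * (D / r) < 0 := by
    intro h1 h2
    have e : φ ξ - v = q + p := by linarith
    rw [e] at h2
    have h3 : μ ^ 2 * p ≤ κ * p := by gcongr
    have h4 : 0 < κ * q := by positivity
    linarith
  rcases lt_or_ge ξ (-y) with hlt | hge
  · obtain ⟨h1, h2⟩ := hk.left ξ (hlt.le.trans hy.left)
    refine hflat ?_ (hk.slope_one v (φ ξ) (by linarith) hvφ hφ1)
    have h3 : Real.exp (l * ξ) ≤ Real.exp (-(l / 2) * y) * Real.exp (-(l / 2) * y) := by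
      rw [← Real.exp_add, Real.exp_le_exp]
      nlinarith
    have hX : 0 ≤ D / (c * y ^ 2) + N / y ^ 3 := by positivity
    have hDr : D / r ≤ D / L := by gcongr
    have hDr0 : 0 ≤ D / r := by positivity
    have h5 := hy.decay_le
    calc deriv φ ξ * (D / (c * y ^ 2) + N / y ^ 3 - D / r)
        ≤ -deriv φ ξ * (D / r) := by nlinarith
      _ ≤ C * (Real.exp (-(l / 2) * y) * Real.exp (-(l / 2) * y)) * (D / L) := by
        have := hk.C_nonneg
        refine mul_le_mul (h2.trans ?_) hDr hDr0 (by positivity)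
        gcongr
      _ = C * (D / L) * Real.exp (-(l / 2) * y) * Real.exp (-(l / 2) * y) := by ring
      _ ≤ κ * δ / 4 * Real.exp (-(l / 2) * y) := by gcongr
      _ = κ / 4 * q := by rw [hq]; ring
  · have hNy : 0 ≤ 2 * N / y := by positivity
    have hr1 : c * y ^ 2 - r ≤ 2 * y := by linarith [hy.log_le]
    have hr2 : c * y ^ 2 / 2 ≤ r := by nlinarith [hy.four_le]
    have hcy : 0 < c * y ^ 2 := by positivity
    have hfac := drift_lower_bound hc hD (by linarith : 0 < y) hr1 hr2
    rw [← hN] at hfac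
    have hfac0 : 0 < N / y ^ 3 / 2 := by positivity
    have hneg : deriv φ ξ * (D / (c * y ^ 2) + N / y ^ 3 - D / r) ≤ 0 :=
      mul_nonpos_of_nonpos_of_nonneg hφ' (hfac0.le.trans hfac)
    have hneg' : deriv φ ξ * (D / (c * y ^ 2) + N / y ^ 3 - D / r) ≤ κ / 4 * q :=
      hneg.trans (by positivity)
    rcases le_total (φ ξ) η with hη | hη
    · exact hflat hneg' (hk.slope_zero v (φ ξ) hv0 hvφ hη)
    rcases le_total (1 - η / 2) (φ ξ) with hη' | hη'
    · exact hflat hneg' (hk.slope_one v (φ ξ) (by linarith) hvφ hφ1)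
    have h1 := hk.slope_mid v (φ ξ) hv0 hvφ hφ1
    rw [show φ ξ - v = q + p by linarith] at h1
    have h2 : deriv φ ξ * (D / (c * y ^ 2) + N / y ^ 3 - D / r) ≤ -(m * (N / y ^ 3 / 2)) := by
      have h3 := hk.mid ξ hη hη'
      nlinarith
    have h3 : p ≤ δ * Real.exp (μ * L) * Real.exp (-(μ * c / 2) * y) := by
      rw [hp, mul_assoc, ← Real.exp_add]
      gcongr
      have : μ * (c * y / 2) ≤ μ * r := by
        gcongr
        nlinarith
      linarith
    have h4 := hy.mid
    have h5 : μ ^ 2 * p ≤ 1 * p := by gcongr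
    have h6 : (M + 1) * p ≤
        (M + 1) * (δ * Real.exp (μ * L) * Real.exp (-(μ * c / 2) * y)) := by gcongr
    have h7 : 0 < κ * q := by positivity
    linarith

/-- The radial subsolution at shifted time `s`. -/
def radialBarrier {d : ℕ} (φ : ℝ → ℝ) (c L l δ μ s : ℝ) (x : Euc d) : ℝ :=
  φ (‖x‖ - c * s + d / c * Real.log s - 2 * (8 * d / c ^ 2 + 1) / √s)
    - δ * Real.exp (-(l / 2) * √s) - δ * Real.exp (-μ * (‖x‖ - L))

theorem hasDerivAt_radialBarrier {d : ℕ} {f φ : ℝ → ℝ} {θ c : ℝ} (hφ : PlanarFront f θ c φ)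
    (L l δ μ : ℝ) {s y : ℝ} (hy : 0 < y) (hs : s = y ^ 2) (x : Euc d) :
    HasDerivAt (fun s => radialBarrier φ c L l δ μ s x)
      (deriv φ (‖x‖ - c * y ^ 2 + d / c * Real.log (y ^ 2) - 2 * (8 * d / c ^ 2 + 1) / y) *
        (-c + d / (c * y ^ 2) + (8 * d / c ^ 2 + 1) / y ^ 3) +
        δ * Real.exp (-(l / 2) * y) * (l / (4 * y))) s := by
  have hs0 : 0 < s := by rw [hs]; positivity
  have hsy : √s = y := by rw [hs, Real.sqrt_sq hy.le]
  have hsq := Real.hasDerivAt_sqrt hs0.ne'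
  have hc := hφ.cpos
  have h1 : HasDerivAt
      (fun s => ‖x‖ - c * s + d / c * Real.log s - 2 * (8 * d / c ^ 2 + 1) / √s)
      (-c + d / (c * y ^ 2) + (8 * d / c ^ 2 + 1) / y ^ 3) s := by
    have h := ((((hasDerivAt_id' s).const_mul c).const_sub ‖x‖).add
      ((Real.hasDerivAt_log hs0.ne').const_mul ((d : ℝ) / c))).sub
      ((hasDerivAt_const s (2 * (8 * (d : ℝ) / c ^ 2 + 1))).div hsq (Real.sqrt_pos.2 hs0).ne')
    refine h.congr_deriv ?_
    rw [hsy, hs]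
    field_simp
    ring
  have h2 : HasDerivAt (fun s => δ * Real.exp (-(l / 2) * √s))
      (-(δ * Real.exp (-(l / 2) * y) * (l / (4 * y)))) s := by
    refine ((hsq.const_mul (-(l / 2))).exp.const_mul δ).congr_deriv ?_
    rw [hsy]
    field_simp
    ring
  have h3 := hφ.hasDerivAt
    (‖x‖ - c * s + d / c * Real.log s - 2 * (8 * d / c ^ 2 + 1) / √s)
  refine (((h3.comp s h1).sub h2).sub_const (δ * Real.exp (-μ * (‖x‖ - L)))).congr_deriv ?_
  rw [hsy, hs]
  ring

theorem lapData_radialBarrier {d : ℕ} {f φ : ℝ → ℝ} {θ c : ℝ} (hφ : PlanarFront f θ c φ)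
    (L l δ μ s : ℝ) {x : Euc d} (hx : x ≠ 0) {ξ : ℝ}
    (hξ : ξ = ‖x‖ - c * s + d / c * Real.log s - 2 * (8 * d / c ^ 2 + 1) / √s) :
    ∃ b : ℝ, LapData (radialBarrier φ c L l δ μ s) x (b • innerSL ℝ x)
      (-c * deriv φ ξ - f (φ ξ) - μ ^ 2 * (δ * Real.exp (-μ * (‖x‖ - L))) +
        (deriv φ ξ + μ * (δ * Real.exp (-μ * (‖x‖ - L)))) * (d / ‖x‖)) := by
  set w := -(c * s) + d / c * Real.log s - 2 * (8 * d / c ^ 2 + 1) / √s with hw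
  set q := δ * Real.exp (-(l / 2) * √s) with hq
  have hexp : ∀ z : ℝ, HasDerivAt (fun z => Real.exp (-μ * (z - L)))
      (Real.exp (-μ * (z - L)) * -μ) z := fun z => by
    simpa using (((hasDerivAt_id' z).sub_const L).const_mul (-μ)).exp
  have hshift : ∀ z : ℝ, HasDerivAt (fun z => φ (z + w)) (deriv φ (z + w)) z := fun z => by
    simpa using (hφ.hasDerivAt (z + w)).comp_add_const z w
  have h := (LapData.of_norm hx).comp_of_hasDerivAt
    (Ψ := fun z => φ (z + w) - q - δ * Real.exp (-μ * (z - L)))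
    (Ψ' := fun z => deriv φ (z + w) + μ * (δ * Real.exp (-μ * (z - L))))
    (p := -c * deriv φ (‖x‖ + w) - f (φ (‖x‖ + w)) - μ ^ 2 * (δ * Real.exp (-μ * (‖x‖ - L))))
    (by
      have h1 : ContDiff ℝ 2 fun z => φ (z + w) := hφ.smooth.comp (contDiff_id.add contDiff_const)
      refine ContDiff.contDiffAt ((h1.sub contDiff_const).sub ?_)
      fun_prop)
    (Eventually.of_forall fun z => by
      refine (((hshift z).sub_const q).sub ((hexp z).const_mul δ)).congr_deriv ?_
      ring)
    (by
      refine (((hφ.hasDerivAt_deriv (‖x‖ + w)).comp_add_const ‖x‖ w).add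
        (((hexp ‖x‖).const_mul δ).const_mul μ)).congr_deriv ?_
      ring)
  have hB : radialBarrier φ c L l δ μ s =
      fun y : Euc d => φ (‖y‖ + w) - q - δ * Real.exp (-μ * (‖y‖ - L)) := by
    ext y
    simp only [radialBarrier, hw, hq]
    congr 4
    ring
  have hξw : ‖x‖ + w = ξ := by
    rw [hξ, hw]
    ring
  have hn : ‖x‖ ≠ 0 := norm_ne_zero_iff.2 hx
  refine ⟨(deriv φ ξ + μ * (δ * Real.exp (-μ * (‖x‖ - L)))) * ‖x‖⁻¹, ?_⟩
  rw [hB]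
  refine h.congr ?_ ?_
  · rw [hξw, smul_smul]
  · simp only [smul_apply, smul_eq_mul, mul_pow, ← Finset.mul_sum, sum_innerSL_single_sq, hξw]
    rw [← mul_pow, inv_mul_cancel₀ hn]
    ring

theorem continuousOn_radialBarrier {d : ℕ} {f φ : ℝ → ℝ} {θ c : ℝ} (hφ : PlanarFront f θ c φ)
    (L l δ μ : ℝ) :
    ContinuousOn (fun p : ℝ × Euc d => radialBarrier φ c L l δ μ p.1 p.2) (Ioi 0 ×ˢ univ) := by
  have hc : Continuous φ := hφ.smooth.continuous
  have hpos : ∀ p ∈ Ioi (0 : ℝ) ×ˢ (univ : Set (Euc d)), 0 < p.1 := fun p hp => hp.1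
  unfold radialBarrier
  refine ContinuousOn.sub (ContinuousOn.sub (hc.comp_continuousOn ?_) ?_) ?_
  · refine ContinuousOn.sub (ContinuousOn.add (by fun_prop) ?_) ?_
    · exact continuousOn_const.mul (continuousOn_fst.log fun p hp => (hpos p hp).ne')
    · exact continuousOn_const.div (by fun_prop) fun p hp => (Real.sqrt_pos.2 (hpos p hp)).ne'
  · fun_prop
  · fun_prop

theorem ConeSol.radialBarrier_step {d : ℕ} {K L : ℝ} {f φ : ℝ → ℝ} {u : ℝ → Euc d → ℝ}
    {θ c κ η M l C A m δ μ y : ℝ} (hu : ConeSol d K L f u) (hf : Bistable f θ)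
    (hφ : PlanarFront f θ c φ) (hk : FrontConstants f φ κ η M l C A m) (hδ : 0 < δ)
    (hδη : 4 * δ ≤ η) (hμ : 0 < μ) (hμ1 : μ ^ 2 ≤ 1) (hμκ : μ ^ 2 ≤ κ)
    (hy : LateTime c d L κ M l C A m δ μ y) {t s : ℝ} (hs : s = y ^ 2) {x : Euc d}
    (hx : x ∈ coneEnd d K L) (heq : radialBarrier φ c L l δ μ s x = u t x) :
    ∃ Bt b : ℝ, ∃ G : Euc d →L[ℝ] ℝ,
      HasDerivAt (fun s => radialBarrier φ c L l δ μ s x) Bt s ∧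
      LapData (radialBarrier φ c L l δ μ s) x G b ∧
      (‖x‖ = K * x 0 → G (outward K x) ≤ 0) ∧ Bt < b + f (u t x) := by
  have hy0 : 0 < y := by linarith [hy.one_le]
  have hsy : √s = y := by rw [hs, Real.sqrt_sq hy0.le]
  have hx0 : x ≠ 0 := norm_pos_iff.1 (hu.L_pos.trans hx.2)
  obtain ⟨b, hb⟩ := lapData_radialBarrier hφ L l δ μ s hx0 rfl
  refine ⟨_, _, _, hasDerivAt_radialBarrier hφ L l δ μ hy0 hs x, hb, ?_, ?_⟩
  · intro hxb
    have h1 : inner ℝ x (outward K x) = 0 := by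
      rw [real_inner_comm, inner_outward, real_inner_self_eq_norm_sq, hxb]
      ring
    simp [h1]
  · have hres := radial_residual_neg (D := d) (v := u t x) hf hφ (Nat.cast_nonneg d) hu.L_pos hk hδ
      hδη hμ hμ1 hμκ hy hx.2.le rfl (by rw [← heq, radialBarrier, hsy, hs])
      (hu.range01 t x hx).1
    rw [hsy, hs]
    linarith

theorem radialBarrier_lt_of_pos {d : ℕ} {f φ : ℝ → ℝ} {θ c L l δ μ s : ℝ}
    (hφ : PlanarFront f θ c φ) (hδ : 0 < δ) (x : Euc d) :
    radialBarrier φ c L l δ μ s x < 1 - δ * Real.exp (-(l / 2) * √s) ∧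
      radialBarrier φ c L l δ μ s x < 1 - δ * Real.exp (-μ * (‖x‖ - L)) := by
  have h1 := (hφ.mem (‖x‖ - c * s + d / c * Real.log s - 2 * (8 * d / c ^ 2 + 1) / √s)).2
  have h2 : 0 < δ * Real.exp (-(l / 2) * √s) := by positivity
  have h3 : 0 < δ * Real.exp (-μ * (‖x‖ - L)) := by positivity
  unfold radialBarrier
  constructor <;> linarith

theorem exists_radialBarrier_neg {d : ℕ} {f φ : ℝ → ℝ} {θ c L l δ μ : ℝ}
    (hφ : PlanarFront f θ c φ) (hl : 0 < l) (hδ : 0 < δ) (b : ℝ) :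
    ∃ ρ : ℝ, ∀ s ∈ Icc 1 b, ∀ x : Euc d, ρ ≤ ‖x‖ → radialBarrier φ c L l δ μ s x < 0 := by
  have hc := hφ.cpos
  obtain ⟨Z, hZ⟩ := eventually_atTop.1 (hφ.lim_top.eventually
    (gt_mem_nhds (by positivity : 0 < δ * Real.exp (-(l / 2) * √b))))
  refine ⟨Z + c * b + 2 * (8 * d / c ^ 2 + 1), fun s hs x hx => ?_⟩
  have hs1 : 1 ≤ √s := Real.one_le_sqrt.2 hs.1
  have h1 : 0 ≤ d / c * Real.log s := mul_nonneg (by positivity) (Real.log_nonneg hs.1)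
  have h2 : 2 * (8 * d / c ^ 2 + 1) / √s ≤ 2 * (8 * d / c ^ 2 + 1) :=
    div_le_self (by positivity) hs1
  have h3 : c * s ≤ c * b := by gcongr; exact hs.2
  have h4 := hZ (‖x‖ - c * s + d / c * Real.log s - 2 * (8 * d / c ^ 2 + 1) / √s) (by linarith)
  have h5 : δ * Real.exp (-(l / 2) * √b) ≤ δ * Real.exp (-(l / 2) * √s) := by
    have h6 : √s ≤ √b := Real.sqrt_le_sqrt hs.2
    refine mul_le_mul_of_nonneg_left (Real.exp_le_exp.2 ?_) hδ.le
    nlinarith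
  have h7 : 0 < δ * Real.exp (-μ * (‖x‖ - L)) := by positivity
  unfold radialBarrier
  linarith

theorem ConeSol.radialBarrier_lt {d : ℕ} {K L : ℝ} {f φ : ℝ → ℝ} {u : ℝ → Euc d → ℝ}
    {θ c κ η M l C A m δ μ y₀ τ₂ : ℝ} (hu : ConeSol d K L f u) (hf : Bistable f θ)
    (hφ : PlanarFront f θ c φ) (hk : FrontConstants f φ κ η M l C A m) (hδ : 0 < δ)
    (hδη : 4 * δ ≤ η) (hμ : 0 < μ) (hμ1 : μ ^ 2 ≤ 1) (hμκ : μ ^ 2 ≤ κ)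
    (hlate : ∀ y ≥ y₀, LateTime c d L κ M l C A m δ μ y)
    (hnear : ∀ t ≥ τ₂, ∀ x ∈ coneEnd d K L, ‖x‖ ≤ L + 1 → 1 - δ * Real.exp (-μ) ≤ u t x)
    (hinit : ∀ x ∈ coneEnd d K L, radialBarrier φ c L l δ μ (y₀ ^ 2) x < u τ₂ x)
    {t : ℝ} (ht : τ₂ ≤ t) {x : Euc d} (hx : x ∈ coneEnd d K L) (hxL : L + 1 ≤ ‖x‖) :
    radialBarrier φ c L l δ μ (t - τ₂ + y₀ ^ 2) x < u t x := by
  have hy₀ : 1 ≤ y₀ := (hlate y₀ le_rfl).one_le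
  have hy₀2 : 1 ≤ y₀ ^ 2 := one_le_pow₀ hy₀
  obtain ⟨ρ, hρ⟩ := exists_radialBarrier_neg (d := d) (L := L) (μ := μ) hφ hk.l_pos hδ
    (t - τ₂ + y₀ ^ 2)
  set ρ' := max ρ (‖x‖ + 1) with hρ'
  set Q : Set (Euc d) := {z | ‖z‖ ≤ K * z 0 ∧ L + 1 / 2 ≤ ‖z‖ ∧ ‖z‖ ≤ ρ'} with hQ
  have hQc : IsCompact Q := by
    refine (isCompact_closedBall (0 : Euc d) ρ').of_isClosed_subset ?_ fun z hz => ?_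
    · exact (isClosed_le continuous_norm (continuous_const.mul (continuous_coord 0))).inter
        ((isClosed_le continuous_const continuous_norm).inter
          (isClosed_le continuous_norm continuous_const))
    · simpa using hz.2.2
  have hQX : Q ⊆ coneEnd d K L := fun z hz => ⟨hz.1, by linarith [hz.2.1]⟩
  have hxQ : x ∈ Q := ⟨hx.1, by linarith, by linarith [le_max_right ρ (‖x‖ + 1)]⟩
  refine hu.lt_of_barrier (B := fun s => radialBarrier φ c L l δ μ (s - τ₂ + y₀ ^ 2))
    (a := τ₂) (b := t) hQc hQX ?_ ?_ ?_ ?_ t ⟨ht, le_rfl⟩ x hxQ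
  · refine (continuousOn_radialBarrier hφ L l δ μ).comp
      (f := fun p : ℝ × Euc d => (p.1 - τ₂ + y₀ ^ 2, p.2))
      (Continuous.continuousOn (by fun_prop)) fun p hp => ⟨?_, mem_univ _⟩
    have h1 : τ₂ ≤ p.1 := hp.1.1
    show 0 < p.1 - τ₂ + y₀ ^ 2
    linarith
  · exact fun s _ z hz => hu.rightLSCAt hf.smooth.continuous s (hQX hz)
  · intro z hz
    simpa using hinit z (hQX hz)
  · intro s hs z hz heq
    have hzX := hQX hz
    have hs1 : y₀ ^ 2 ≤ s - τ₂ + y₀ ^ 2 := by linarith [hs.1]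
    have hL1 : L + 1 < ‖z‖ := by
      by_contra! hle
      have h1 := hnear s hs.1.le z hzX hle
      have h2 := (radialBarrier_lt_of_pos (L := L) (l := l) (μ := μ) (s := s - τ₂ + y₀ ^ 2)
        hφ hδ z).2
      have h3 : δ * Real.exp (-μ) ≤ δ * Real.exp (-μ * (‖z‖ - L)) := by
        gcongr
        nlinarith
      linarith
    have hρz : ‖z‖ < ρ' := by
      by_contra! hle
      have h1 := hρ (s - τ₂ + y₀ ^ 2) ⟨by linarith, by linarith [hs.2]⟩ z
        ((le_max_left _ _).trans hle)
      have h2 := (hu.range01 s z hzX).1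
      linarith
    constructor
    · have h1 : ∀ᶠ w : Euc d in 𝓝[coneEnd d K L] z, L + 1 < ‖w‖ :=
        nhdsWithin_le_nhds (continuous_norm.continuousAt.eventually (lt_mem_nhds hL1))
      have h2 : ∀ᶠ w : Euc d in 𝓝[coneEnd d K L] z, ‖w‖ < ρ' :=
        nhdsWithin_le_nhds (continuous_norm.continuousAt.eventually (gt_mem_nhds hρz))
      filter_upwards [h1, h2, self_mem_nhdsWithin] with w hw1 hw2 hw3
      exact ⟨hw3.1, by linarith, hw2.le⟩
    · have hy : LateTime c d L κ M l C A m δ μ √(s - τ₂ + y₀ ^ 2) :=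
        hlate _ (Real.le_sqrt_of_sq_le hs1)
      obtain ⟨Bt, b, G, h1, h2, h3, h4⟩ := hu.radialBarrier_step hf hφ hk hδ hδη hμ hμ1 hμκ hy
        (Real.sq_sqrt (by linarith)).symm hzX heq
      refine ⟨Bt, b, G, ?_, h2, h3, h4⟩
      simpa using HasDerivAt.comp_add_const s (y₀ ^ 2 - τ₂)
        (f := fun s => radialBarrier φ c L l δ μ s z) (f' := Bt)
        (by rwa [show s + (y₀ ^ 2 - τ₂) = s - τ₂ + y₀ ^ 2 by ring])
          |>.congr_of_eventuallyEq (Eventually.of_forall fun r => by ring_nf)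

theorem ConeSol.front_lower_bound {d : ℕ} {K L : ℝ} {f φ : ℝ → ℝ} {u : ℝ → Euc d → ℝ} {θ c : ℝ}
    (hu : ConeSol d K L f u) (hf : Bistable f θ) (hφ : PlanarFront f θ c φ) {S : Set (Euc d)}
    (hXS : coneEnd d K L ⊆ S) (hSX : ∀ x ∈ S, L < ‖x‖ → x ∈ coneEnd d K L)
    (hconv : ∀ ε > 0, ∀ ρ : ℝ, ∃ T : ℝ, ∀ t ≥ T, ∀ x ∈ S, ‖x‖ ≤ ρ → 1 - ε ≤ u t x) :
    ∃ τ > (0 : ℝ), ∃ τ₂ z₂ : ℝ, ∃ δ > (0 : ℝ), ∃ μ > (0 : ℝ),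
      ∀ t : ℝ, τ₂ ≤ t → ∀ x ∈ S, L ≤ ‖x‖ →
        φ (‖x‖ - c * (t - τ₂ + τ) + ((d : ℝ) / c) * Real.log (t - τ₂ + τ) + z₂)
            - δ * Real.exp (-δ * varTheta (t - τ₂))
            - δ * Real.exp (-μ * (‖x‖ - L))
          ≤ u t x := by
  obtain ⟨κ, η, M, l, C, A, m, hk⟩ := hφ.exists_frontConstants hf
  have hκ := hk.κ_pos
  have hη := hk.η_mem.1
  have hc := hφ.cpos
  set δ := η / 4 with hδ
  have hδ0 : 0 < δ := by positivity
  set μ := min 1 κ with hμ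
  have hμ0 : 0 < μ := lt_min one_pos hκ
  have hμ1 : μ ≤ 1 := min_le_left _ _
  have hμκ : μ ≤ κ := min_le_right _ _
  obtain ⟨y₀, hlate⟩ := eventually_atTop.1 (eventually_lateTime (L := L) (M := M) (C := C) (A := A)
    hc (Nat.cast_nonneg d) hκ hk.l_pos hk.m_pos hδ0 hμ0)
  have hy₀ : 1 ≤ y₀ := (hlate y₀ le_rfl).one_le
  have hy₀2 : 1 ≤ y₀ ^ 2 := one_le_pow₀ hy₀
  obtain ⟨ρ, hρ⟩ := exists_radialBarrier_neg (d := d) (L := L) (μ := μ) hφ hk.l_pos hδ0 (y₀ ^ 2)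
  obtain ⟨T₁, hT₁⟩ := hconv (δ * Real.exp (-μ)) (by positivity) (L + 1)
  obtain ⟨T₂, hT₂⟩ := hconv (δ * Real.exp (-(l / 2) * √(y₀ ^ 2))) (by positivity) ρ
  refine ⟨y₀ ^ 2, by linarith, max T₁ T₂, 0, δ, hδ0, μ, hμ0, fun t ht x hx hxL => ?_⟩
  set τ₂ := max T₁ T₂ with hτ₂
  rcases le_or_gt ‖x‖ (L + 1) with hle | hgt
  · have h1 := hT₁ t ((le_max_left _ _).trans ht) x hx hle
    have h2 := (hφ.mem (‖x‖ - c * (t - τ₂ + y₀ ^ 2) +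
      ((d : ℝ) / c) * Real.log (t - τ₂ + y₀ ^ 2) + 0)).2
    have h3 : 0 < δ * Real.exp (-δ * varTheta (t - τ₂)) := by positivity
    have h4 : δ * Real.exp (-μ) ≤ δ * Real.exp (-μ * (‖x‖ - L)) := by
      gcongr
      nlinarith
    linarith
  · have hxX := hSX x hx (by linarith)
    have hlt := hu.radialBarrier_lt hf hφ hk hδ0 (by linarith) hμ0 (by nlinarith) (by nlinarith)
      hlate (τ₂ := τ₂) (fun s hs z hz hzL => hT₁ s ((le_max_left _ _).trans hs) z (hXS hz) hzL)
      (fun z hz => by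
        rcases le_or_gt ‖z‖ ρ with hzρ | hzρ
        · have h1 := hT₂ τ₂ (le_max_right _ _) z (hXS hz) hzρ
          have h2 := (radialBarrier_lt_of_pos (L := L) (l := l) (μ := μ) (s := y₀ ^ 2) hφ hδ0 z).1
          linarith
        · have h1 := hρ (y₀ ^ 2) ⟨hy₀2, le_rfl⟩ z hzρ.le
          have h2 := (hu.range01 τ₂ z hz).1
          linarith) ht hxX hgt.le
    refine le_trans ?_ hlt.le
    set s := t - τ₂ + y₀ ^ 2 with hs
    have hs1 : y₀ ^ 2 ≤ s := by linarith
    have hs0 : 0 ≤ s := by linarith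
    have h1 : φ (‖x‖ - c * s + d / c * Real.log s + 0) ≤
        φ (‖x‖ - c * s + d / c * Real.log s - 2 * (8 * d / c ^ 2 + 1) / √s) := by
      refine hφ.anti.antitone ?_
      have : 0 ≤ 2 * (8 * d / c ^ 2 + 1) / √s := by positivity
      linarith
    have h2 : δ * Real.exp (-(l / 2) * √s) ≤ δ * Real.exp (-δ * varTheta (t - τ₂)) := by
      have h3 := (hlate √s (Real.le_sqrt_of_sq_le hs1)).theta_le
      rw [Real.sq_sqrt hs0] at h3
      have h4 : Real.log (t - τ₂ + 1) ^ ((3 : ℝ) / 2) ≤ Real.log s ^ ((3 : ℝ) / 2) := by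
        have h5 : 0 ≤ Real.log (t - τ₂ + 1) := Real.log_nonneg (by linarith)
        have h6 : 0 < t - τ₂ + 1 := by linarith
        have h7 : t - τ₂ + 1 ≤ s := by linarith
        gcongr
      have h8 : δ * varTheta (t - τ₂) ≤ δ * (2 / 3 * Real.log s ^ ((3 : ℝ) / 2)) := by
        unfold varTheta
        gcongr
      refine mul_le_mul_of_nonneg_left (Real.exp_le_exp.2 ?_) hδ0.le
      linarith
    unfold radialBarrier
    linarith

/-! ### The conical end of a funnel-shaped domain -/

theorem sum_eq_zero_coord_add {d : ℕ} (g : Fin (d + 1) → ℝ) :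
    ∑ i, g i = g 0 + ∑ i, if i = 0 then 0 else g i := by
  simp [Fin.sum_univ_succ]

theorem primeNorm_sq {d : ℕ} (x : Euc d) : primeNorm x ^ 2 = ‖x‖ ^ 2 - x 0 ^ 2 := by
  have hnn : 0 ≤ ∑ i, if i = 0 then 0 else (x i) ^ 2 :=
    Finset.sum_nonneg fun i _ => by split_ifs <;> positivity
  rw [primeNorm, Real.sq_sqrt hnn, EuclideanSpace.norm_sq_eq]
  simp only [Real.norm_eq_abs, sq_abs]
  rw [sum_eq_zero_coord_add fun i => x i ^ 2]
  ring

theorem primeNorm_nonneg {d : ℕ} (x : Euc d) : 0 ≤ primeNorm x := Real.sqrt_nonneg _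

theorem continuous_primeNorm {d : ℕ} : Continuous (primeNorm : Euc d → ℝ) := by
  have h : (primeNorm : Euc d → ℝ) = fun x => √(‖x‖ ^ 2 - x 0 ^ 2) := by
    funext x
    rw [← primeNorm_sq, Real.sqrt_sq (primeNorm_nonneg x)]
  rw [h]
  have := continuous_coord (d := d) 0
  fun_prop

theorem primeNorm_add_smul_single {d : ℕ} (x : Euc d) (s : ℝ) :
    primeNorm (x + s • EuclideanSpace.single 0 1) = primeNorm x := by
  unfold primeNorm
  congr 1
  refine Finset.sum_congr rfl fun i _ => ?_
  split_ifs with hi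
  · rfl
  · simp [hi]

theorem IsFunnel.cos_pos {d : ℕ} {R α L : ℝ} {h : ℝ → ℝ} (hΩ : IsFunnel d R α L h) :
    0 < Real.cos α :=
  Real.cos_pos_of_mem_Ioo ⟨by linarith [hΩ.αmem.1, Real.pi_pos], hΩ.αmem.2⟩

theorem IsFunnel.closure_subset {d : ℕ} {R α L : ℝ} {h : ℝ → ℝ} (hΩ : IsFunnel d R α L h) :
    closure (funnel d h) ⊆ {x | primeNorm x ≤ h (x 0)} :=
  closure_minimal (fun x (hx : primeNorm x < h (x 0)) => hx.le) <|
    isClosed_le continuous_primeNorm (hΩ.smooth.continuous.comp (continuous_coord 0))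

theorem IsFunnel.isOpen_funnel {d : ℕ} {R α L : ℝ} {h : ℝ → ℝ} (hΩ : IsFunnel d R α L h) :
    IsOpen (funnel d h) :=
  isOpen_lt continuous_primeNorm (hΩ.smooth.continuous.comp (continuous_coord 0))

theorem IsFunnel.closure_inter {d : ℕ} {R α L : ℝ} {h : ℝ → ℝ} (hΩ : IsFunnel d R α L h)
    (hα : 0 < α) :
    closure (funnel d h) ∩ {x | 0 < x 0 ∧ L < ‖x‖} = coneEnd d (Real.cos α)⁻¹ L := by
  have hcos := hΩ.cos_pos
  have hsc := Real.sin_sq_add_cos_sq α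
  have hsin : 0 < Real.sin α :=
    Real.sin_pos_of_pos_of_lt_pi hα (by linarith [hΩ.αmem.2, Real.pi_pos])
  have htan : 0 < Real.tan α := Real.tan_pos_of_pos_of_lt_pi_div_two hα hΩ.αmem.2
  have htc : Real.tan α * Real.cos α = Real.sin α := Real.tan_mul_cos hcos.ne'
  have hL : 0 < L := hΩ.Rpos.trans hΩ.RL
  have hmono : Monotone h := monotone_of_deriv_nonneg
    (hΩ.smooth.differentiable (by simp)) hΩ.deriv_nonneg
  ext x
  have hsq := primeNorm_sq x
  have hp := primeNorm_nonneg x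
  constructor
  · rintro ⟨hxc, hx0 : 0 < x 0, hxL : L < ‖x‖⟩
    have hle : primeNorm x ≤ h (x 0) := hΩ.closure_subset hxc
    refine ⟨?_, hxL⟩
    rw [inv_mul_eq_div, le_div_iff₀ hcos]
    rcases le_or_gt (x 0) (L * Real.cos α) with hx | hx
    · have h1 : primeNorm x ≤ L * Real.sin α := by
        refine hle.trans ((hmono hx).trans ?_)
        rw [hΩ.right _ le_rfl, ← htc]
        linarith
      have h2 : primeNorm x ^ 2 ≤ (L * Real.sin α) ^ 2 := by gcongr
      have h3 : x 0 ^ 2 ≤ (L * Real.cos α) ^ 2 := by gcongr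
      have h4 : (L * Real.sin α) ^ 2 + (L * Real.cos α) ^ 2 = L ^ 2 := by
        linear_combination L ^ 2 * hsc
      nlinarith
    · rw [hΩ.right _ hx.le] at hle
      have h2 : primeNorm x ^ 2 ≤ (x 0 * Real.tan α) ^ 2 := by gcongr
      refine abs_le_of_sq_le_sq' ?_ hx0.le |>.2
      have h3 : (x 0 * Real.tan α) ^ 2 * Real.cos α ^ 2 = x 0 ^ 2 * Real.sin α ^ 2 := by
        rw [← htc]; ring
      have h4 := mul_le_mul_of_nonneg_right h2 (sq_nonneg (Real.cos α))
      rw [h3, hsq] at h4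
      have h5 : Real.sin α ^ 2 = 1 - Real.cos α ^ 2 := by linarith
      rw [h5] at h4
      nlinarith
  · rintro ⟨hxK, hxL⟩
    rw [inv_mul_eq_div, le_div_iff₀ hcos] at hxK
    have hx : L * Real.cos α < x 0 := (mul_lt_mul_of_pos_right hxL hcos).trans_le hxK
    have hx0 : 0 < x 0 := (mul_pos hL hcos).trans hx
    refine ⟨?_, hx0, hxL⟩
    have hle : primeNorm x ≤ x 0 * Real.tan α := by
      refine abs_le_of_sq_le_sq' ?_ (by positivity) |>.2
      have h1 : ‖x‖ ^ 2 * Real.cos α ^ 2 ≤ x 0 ^ 2 := by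
        rw [← mul_pow]; gcongr
      have h3 : (x 0 * Real.tan α) ^ 2 * Real.cos α ^ 2 = x 0 ^ 2 * Real.sin α ^ 2 := by
        rw [← htc]; ring
      refine le_of_mul_le_mul_right ?_ (pow_pos hcos 2)
      rw [h3, hsq]
      nlinarith
    have hcont : Continuous fun s : ℝ => x + s • (EuclideanSpace.single 0 1 : Euc d) := by fun_prop
    have hlim : Tendsto (fun s : ℝ => x + s • (EuclideanSpace.single 0 1 : Euc d)) (𝓝[>] 0)
        (𝓝 x) := by
      have := hcont.tendsto 0
      simp only [zero_smul, add_zero] at this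
      exact this.mono_left nhdsWithin_le_nhds
    refine mem_closure_of_tendsto hlim ?_
    filter_upwards [self_mem_nhdsWithin] with s hs
    have hs0 : (0 : ℝ) < s := hs
    show primeNorm _ < h _
    rw [primeNorm_add_smul_single]
    have h0 : (x + s • (EuclideanSpace.single 0 1 : Euc d)) 0 = x 0 + s := by simp
    rw [h0, hΩ.right _ (by linarith)]
    nlinarith

theorem isOpen_coord_pos_norm_gt (d : ℕ) (L : ℝ) : IsOpen {x : Euc d | 0 < x 0 ∧ L < ‖x‖} :=
  (isOpen_lt continuous_const (continuous_coord 0)).inter (isOpen_lt continuous_const continuous_norm)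

theorem lapW_inter {d : ℕ} {s t : Set (Euc d)} (ht : IsOpen t) (g : Euc d → ℝ) {x : Euc d}
    (hx : x ∈ s ∩ t) : lapW (s ∩ t) g x = lapW s g x := by
  unfold lapW
  refine Finset.sum_congr rfl fun i _ => ?_
  rw [fderivWithin_inter (ht.mem_nhds hx.2)]
  congr 1
  refine EventuallyEq.fderivWithin_eq_of_nhds ?_
  filter_upwards [ht.mem_nhds hx.2] with y hy
  rw [fderivWithin_inter (ht.mem_nhds hy)]

theorem IsEntireSolution.coneSol {d : ℕ} {f φ h : ℝ → ℝ} {c R α L : ℝ} (hΩ : IsFunnel d R α L h)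
    (hα : 0 < α) {u : ℝ → Euc d → ℝ} (hu : IsEntireSolution d h f c φ u) :
    ConeSol d (Real.cos α)⁻¹ L f u := by
  have hcos := hΩ.cos_pos
  have hL : 0 < L := hΩ.Rpos.trans hΩ.RL
  have hX := hΩ.closure_inter hα
  have hopen := isOpen_coord_pos_norm_gt d L
  have hsub : coneEnd d (Real.cos α)⁻¹ L ⊆ closure (funnel d h) := hX ▸ inter_subset_left
  have hcos1 : Real.cos α < 1 := by
    have h1 : 0 < Real.sin α :=
      Real.sin_pos_of_pos_of_lt_pi hα (by linarith [hΩ.αmem.2, Real.pi_pos])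
    nlinarith [Real.sin_sq_add_cos_sq α]
  refine ⟨(one_lt_inv₀ hcos).2 hcos1, hL, fun t x hx => hu.range01 t x (hsub hx),
    fun x hx => hu.time_diff x (hsub hx), fun t => (hu.space_reg t).mono hsub, fun t x hx => ?_,
    fun t x hx hxK => ?_⟩
  · rw [hu.pde t x (hsub hx), ← hX, lapW_inter hopen _ (hX ▸ hx)]
  · have hxL := hx.2
    rw [← hX] at hx
    rw [← hX, fderivWithin_inter (hopen.mem_nhds hx.2)]
    have hx0 : 0 < x 0 := hx.2.1
    have htan : 0 < Real.tan α := Real.tan_pos_of_pos_of_lt_pi_div_two hα hΩ.αmem.2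
    have hxcos : ‖x‖ * Real.cos α = x 0 := by rw [hxK]; field_simp
    have hxe : L * Real.cos α < x 0 := hxcos ▸ mul_lt_mul_of_pos_right hxL hcos
    have hK2 : (Real.cos α)⁻¹ ^ 2 = 1 + Real.tan α ^ 2 := by
      rw [inv_pow, Real.inv_one_add_tan_sq hcos.ne' |>.symm, inv_inv]
    have hprime : primeNorm x = x 0 * Real.tan α := by
      refine (sq_eq_sq₀ (primeNorm_nonneg x) (by positivity)).1 ?_
      rw [primeNorm_sq, hxK, mul_pow, hK2]
      ring
    have hderiv : deriv h (x 0) = Real.tan α := by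
      have hev : h =ᶠ[𝓝 (x 0)] fun y => y * Real.tan α := by
        filter_upwards [lt_mem_nhds hxe] with y hy using hΩ.right y hy.le
      rw [hev.deriv_eq]
      simp
    have hfr : x ∈ frontier (funnel d h) := by
      rw [hΩ.isOpen_funnel.frontier_eq]
      refine ⟨hx.1, fun hmem => ?_⟩
      have hlt : primeNorm x < h (x 0) := hmem
      rw [hprime, hΩ.right _ hxe.le] at hlt
      exact lt_irrefl _ hlt
    have hneu := hu.neumann t x hfr
    rw [neumannLHS, hderiv, hprime] at hneu
    set G := fderivWithin ℝ (u t) (closure (funnel d h)) x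
    have hsqrt : (√(1 + Real.tan α ^ 2))⁻¹ ≠ 0 := by positivity
    have hneu' := (mul_eq_zero.1 hneu).resolve_left hsqrt
    have hGx : G x = x 0 * G (EuclideanSpace.single 0 1) +
        ∑ i, if i = 0 then 0 else x i * G (EuclideanSpace.single i 1) := by
      have hsum : x = ∑ i, x i • (EuclideanSpace.single i 1 : Euc d) := by
        ext j
        simp [Pi.single_apply]
      conv_lhs => rw [hsum]
      rw [map_sum, sum_eq_zero_coord_add]
      simp only [map_smul, smul_eq_mul]
    have hsum : x 0 * Real.tan α * (∑ i, if i = 0 then 0 else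
        (x i / (x 0 * Real.tan α)) * G (EuclideanSpace.single i 1)) =
        ∑ i, if i = 0 then 0 else x i * G (EuclideanSpace.single i 1) := by
      rw [Finset.mul_sum]
      refine Finset.sum_congr rfl fun i _ => ?_
      split_ifs
      · simp
      · field_simp
    rw [outward, map_sub, map_smul, hGx, hK2, smul_eq_mul, ← hsum]
    linear_combination x 0 * Real.tan α * hneu'

theorem CompletePropagation.eventually_ge {d : ℕ} {h : ℝ → ℝ} {u : ℝ → Euc d → ℝ}
    (hprop : CompletePropagation d h u) {ε : ℝ} (hε : 0 < ε) (ρ : ℝ) :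
    ∃ T : ℝ, ∀ t ≥ T, ∀ x ∈ closure (funnel d h), ‖x‖ ≤ ρ → 1 - ε ≤ u t x := by
  have hcpt : IsCompact (closure (funnel d h) ∩ Metric.closedBall 0 ρ) :=
    (isCompact_closedBall 0 ρ).inter_left isClosed_closure
  have hunif := (tendstoLocallyUniformlyOn_iff_tendstoUniformlyOn_of_compact hcpt).1
    (hprop.mono inter_subset_left)
  obtain ⟨T, hT⟩ := eventually_atTop.1 (Metric.tendstoUniformlyOn_iff.1 hunif ε hε)
  refine ⟨T, fun t ht x hx hxρ => ?_⟩
  have h1 := hT t ht x ⟨hx, by simpa using hxρ⟩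
  rw [Real.dist_eq] at h1
  linarith [(abs_lt.1 h1).2]

/-- lower bound of Lemma 4.1: in case of complete propagation, a
subsolution-type lower bound for `u` in the conical part, involving the shifted front at
position `|x| - c(t-τ₂+τ) + ((N-1)/c)·ln(t-τ₂+τ) + z₂`. -/
theorem statement16 (d : ℕ) (f φ h : ℝ → ℝ) (θ c R α L : ℝ)
    (hf : Bistable f θ) (hφ : PlanarFront f θ c φ) (hΩ : IsFunnel d R α L h) (hα : 0 < α)
    (u : ℝ → Euc d → ℝ) (hu : IsEntireSolution d h f c φ u)
    (hprop : CompletePropagation d h u) :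
    ∃ τ > (0 : ℝ), ∃ τ₂ z₂ : ℝ, ∃ δ > (0 : ℝ), ∃ μ > (0 : ℝ),
      ∀ t : ℝ, τ₂ ≤ t → ∀ x ∈ closure (funnel d h), 0 < x 0 → L ≤ ‖x‖ →
        φ (‖x‖ - c * (t - τ₂ + τ) + ((d : ℝ) / c) * Real.log (t - τ₂ + τ) + z₂)
            - δ * Real.exp (-δ * varTheta (t - τ₂))
            - δ * Real.exp (-μ * (‖x‖ - L))
          ≤ u t x := by
  have hX := hΩ.closure_inter hα
  obtain ⟨τ, hτ, τ₂, z₂, δ, hδ, μ, hμ, hbound⟩ :=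
    (hu.coneSol hΩ hα).front_lower_bound hf hφ (S := closure (funnel d h) ∩ {x | 0 < x 0})
      (fun x hx => by rw [← hX] at hx; exact ⟨hx.1, hx.2.1⟩)
      (fun x hx hxL => by rw [← hX]; exact ⟨hx.1, hx.2, hxL⟩)
      (fun ε hε ρ => (hprop.eventually_ge hε ρ).imp fun T hT t ht x hx => hT t ht x hx.1)
  exact ⟨τ, hτ, τ₂, z₂, δ, hδ, μ, hμ, fun t ht x hx hx0 hxL => hbound t ht x ⟨hx, hx0⟩ hxL⟩
end
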